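/- Let p ≥ 2 be an integer and α ∈ (1,2). The sequence of normalized collocation matrices {n^{-α} A_n^{p,α}}_n has spectral distribution f^{p,α} on [-π,π]: for every continuous compactly supported F : ℂ → ℂ, lim_{n→∞} (1/(n+p-2)) Σ_{j=1}^{n+p-2} F(λ_j(n^{-α} A_n^{p,α})) = (1/2π) ∫_{-π}^{π} F(f^{p,α}(θ)) dθ, where λ_j(n^{-α} A_n^{p,α}) are the eigenvalues of n^{-α} A_n^{p,α} counted with multiplicity (the roots over ℂ of the characteristic polynomial). -/

import Mathlib

open MeasureTheory

/-- `sin x / x` with value 1 at 0. -/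
noncomputable def sincf (x : ℝ) : ℝ := if x = 0 then 1 else Real.sin x / x

/-- The symbol `f^{p,α}`. -/
noncomputable def fSymbol (p : ℕ) (α : ℝ) (θ : ℝ) : ℝ :=
  ∑' l : ℤ, |θ + 2 * (l : ℝ) * Real.pi| ^ α * sincf (θ / 2 + (l : ℝ) * Real.pi) ^ (p + 1)

/-- Open uniform knot sequence on [0,1]. -/
noncomputable def knot (p n : ℕ) (i : ℕ) : ℝ :=
  if i ≤ p + 1 then 0 else if n + p + 1 ≤ i then 1 else ((i : ℝ) - ((p : ℝ) + 1)) / n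

/-- B-splines of degree `k` (Cox–de Boor recurrence) on the above knots. -/
noncomputable def bspline (p n : ℕ) : ℕ → ℕ → ℝ → ℝ
  | 0, i, x => if knot p n i ≤ x ∧ x < knot p n (i + 1) then 1 else 0
  | (k + 1), i, x =>
      (if knot p n (i + k + 1) = knot p n i then 0
        else (x - knot p n i) / (knot p n (i + k + 1) - knot p n i) * bspline p n k i x)
      + (if knot p n (i + k + 2) = knot p n (i + 1) then 0
        else (knot p n (i + k + 2) - x) / (knot p n (i + k + 2) - knot p n (i + 1))
              * bspline p n k (i + 1) x)

/-- Greville abscissae. -/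
noncomputable def greville (p n : ℕ) (i : ℕ) : ℝ :=
  (∑ j ∈ Finset.range p, knot p n (i + 1 + j)) / p

/-- Left Riemann–Liouville fractional derivative on `[0,1]`, `α ∈ (1,2)`. -/
noncomputable def RLD0x (α : ℝ) (u : ℝ → ℝ) (x : ℝ) : ℝ :=
  (1 / Real.Gamma (2 - α)) *
    deriv (deriv (fun z => ∫ y in (0:ℝ)..z, (z - y) ^ (1 - α) * u y)) x

/-- Right Riemann–Liouville fractional derivative on `[0,1]`, `α ∈ (1,2)`. -/
noncomputable def RLDx1 (α : ℝ) (u : ℝ → ℝ) (x : ℝ) : ℝ :=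
  (1 / Real.Gamma (2 - α)) *
    deriv (deriv (fun z => ∫ y in z..(1:ℝ), (y - z) ^ (1 - α) * u y)) x

/-- Collocation matrix `A_n^L`. -/
noncomputable def ALmat (p n : ℕ) (α : ℝ) : Matrix (Fin (n + p - 2)) (Fin (n + p - 2)) ℝ :=
  Matrix.of fun i j => RLD0x α (bspline p n p ((j : ℕ) + 2)) (greville p n ((i : ℕ) + 2))

/-- Collocation matrix `A_n^R`. -/
noncomputable def ARmat (p n : ℕ) (α : ℝ) : Matrix (Fin (n + p - 2)) (Fin (n + p - 2)) ℝ :=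
  Matrix.of fun i j => RLDx1 α (bspline p n p ((j : ℕ) + 2)) (greville p n ((i : ℕ) + 2))

/-- Full collocation matrix `A_n^{p,α}`. -/
noncomputable def Amat (p n : ℕ) (α : ℝ) : Matrix (Fin (n + p - 2)) (Fin (n + p - 2)) ℝ :=
  (1 / (2 * Real.cos (Real.pi * α / 2))) • (ALmat p n α + ARmat p n α)



section SchurPart
open Matrix Polynomial

lemma aux_fro {n : ℕ} (A : Matrix (Fin n) (Fin n) ℂ) :
    (Aᴴ * A).trace = ((∑ i, ∑ j, ‖A i j‖ ^ 2 : ℝ) : ℂ) := by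
  simp only [Matrix.trace, Matrix.diag, Matrix.mul_apply, Matrix.conjTranspose_apply]
  rw [Finset.sum_comm]
  push_cast
  refine Finset.sum_congr rfl fun i _ => Finset.sum_congr rfl fun j _ => ?_
  have := Complex.conj_mul' (A i j)
  simpa using this

lemma aux_blk_pow {n : ℕ} (B : Matrix (Fin (n+1)) (Fin (n+1)) ℂ) (h : ∀ i : Fin n, B i.succ 0 = 0)
    (k : ℕ) : (∀ i : Fin n, (B ^ k) i.succ 0 = 0) ∧ (B ^ k) 0 0 = (B 0 0) ^ k ∧
      ∀ i j : Fin n, (B ^ k) i.succ j.succ = ((B.submatrix Fin.succ Fin.succ) ^ k) i j := by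
  induction k with
  | zero =>
    refine ⟨fun i => by simp [Matrix.one_apply], by simp, fun i j => by simp [Matrix.one_apply]⟩
  | succ k ih =>
    obtain ⟨h1, h2, h3⟩ := ih
    refine ⟨fun i => ?_, ?_, fun i j => ?_⟩
    · rw [pow_succ, Matrix.mul_apply, Fin.sum_univ_succ]; simp [h1, h]
    · rw [pow_succ, Matrix.mul_apply, Fin.sum_univ_succ]; simp [h2, h, pow_succ]
    · rw [pow_succ, Matrix.mul_apply, Fin.sum_univ_succ, pow_succ, Matrix.mul_apply]; simp [h1, h3]

lemma aux_blk_charpoly {n : ℕ} (B : Matrix (Fin (n+1)) (Fin (n+1)) ℂ)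
    (h : ∀ i : Fin n, B i.succ 0 = 0) :
    B.charpoly = (X - C (B 0 0)) * (B.submatrix Fin.succ Fin.succ).charpoly := by
  unfold Matrix.charpoly
  rw [Matrix.det_succ_column_zero, Fin.sum_univ_succ, Finset.sum_eq_zero]
  · have : (B.charmatrix.submatrix (Fin.succAbove 0) Fin.succ)
        = (B.submatrix Fin.succ Fin.succ).charmatrix := by
      ext1 i j
      simp [Matrix.charmatrix_apply, Matrix.diagonal_apply]
    rw [this]
    simp [Matrix.charmatrix_apply]
  · intro i _
    simp [Matrix.charmatrix_apply, h, Matrix.diagonal_apply]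

lemma aux_exists_unitary {n : ℕ} (A : Matrix (Fin (n+1)) (Fin (n+1)) ℂ) :
    ∃ U : Matrix (Fin (n+1)) (Fin (n+1)) ℂ, Uᴴ * U = 1 ∧ U * Uᴴ = 1 ∧
      ∀ i : Fin n, (Uᴴ * A * U) i.succ 0 = 0 := by
  obtain ⟨μ, hμ⟩ := Module.End.exists_eigenvalue (Matrix.toLin' A)
  obtain ⟨x, hx⟩ := hμ.exists_hasEigenvector
  have hx1 := hx.apply_eq_smul
  have hx0 := hx.2
  rw [Matrix.toLin'_apply] at hx1
  set y : EuclideanSpace ℂ (Fin (n+1)) := WithLp.toLp 2 x with hy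
  have hy0 : y ≠ 0 := by
    intro h; apply hx0; rw [hy] at h; simpa using h
  have hny : ‖y‖ ≠ 0 := by simpa using hy0
  set z : EuclideanSpace ℂ (Fin (n+1)) := ((‖y‖⁻¹ : ℝ) : ℂ) • y with hz
  have hzn : ‖z‖ = 1 := by
    rw [hz, norm_smul]; simp [hny]
  have hAz : A *ᵥ (fun i => z i) = μ • (fun i => z i) := by
    have : (fun i => z i) = ((‖y‖⁻¹ : ℝ) : ℂ) • x := by ext i; simp [hz, hy]
    rw [this, Matrix.mulVec_smul, hx1, smul_comm]
  obtain ⟨b, hb⟩ := Orthonormal.exists_orthonormalBasis_extension_of_card_eq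
    (𝕜 := ℂ) (E := EuclideanSpace ℂ (Fin (n+1))) (ι := Fin (n+1)) (by simp)
    (v := fun _ => z) (s := {0}) (by
      constructor
      · intro i; simpa using hzn
      · intro i j hij; exact absurd (Subsingleton.elim i j) hij)
  have hb0 := hb 0 rfl
  let U : Matrix (Fin (n+1)) (Fin (n+1)) ℂ := Matrix.of fun i j => b j i
  have key : ∀ i j, ∑ k, star (b i k) * b j k = if i = j then 1 else 0 := by
    intro i j
    have := orthonormal_iff_ite.1 b.orthonormal i j
    rw [← this, PiLp.inner_apply]
    refine Finset.sum_congr rfl fun k _ => ?_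
    simp [mul_comm]
  have hU : Uᴴ * U = 1 := by
    ext i j
    rw [Matrix.mul_apply, Matrix.one_apply, ← key i j]
    rfl
  refine ⟨U, hU, mul_eq_one_comm.1 hU, fun i => ?_⟩
  rw [Matrix.mul_assoc, Matrix.mul_apply]
  have h2 : ∀ k, (A * U) k 0 = μ * b 0 k := by
    intro k
    have := congrFun hAz k
    simp only [Matrix.mulVec, dotProduct, Pi.smul_apply, smul_eq_mul] at this
    rw [Matrix.mul_apply, hb0, ← this]
    refine Finset.sum_congr rfl fun l _ => ?_
    simp [U, hb0]
  have h3 := key i.succ 0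
  rw [if_neg (Fin.succ_ne_zero i)] at h3
  calc _ = μ * ∑ k, star (b i.succ k) * b 0 k := by
        rw [Finset.mul_sum]
        refine Finset.sum_congr rfl fun k _ => ?_
        rw [h2]; simp [U]; ring
    _ = 0 := by rw [h3, mul_zero]

theorem schur_main : ∀ (n : ℕ) (A : Matrix (Fin n) (Fin n) ℂ), ∃ v : Fin n → ℂ,
    A.charpoly.roots = Finset.univ.val.map v ∧
    (∑ i, ‖v i‖ ^ 2 ≤ ∑ i, ∑ j, ‖A i j‖ ^ 2) ∧
    ∀ k : ℕ, (A ^ k).trace = ∑ i, v i ^ k := by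
  intro n
  induction n with
  | zero => intro A; exact ⟨fun _ => 0, by simp [Matrix.charpoly], by simp, by simp [Matrix.trace]⟩
  | succ n ih =>
    intro A
    obtain ⟨U, hU, hU', hB⟩ := aux_exists_unitary A
    set B := Uᴴ * A * U with hBdef
    have hpow : ∀ k, B ^ k = Uᴴ * A ^ k * U := by
      intro k
      induction k with
      | zero => simp [hU]
      | succ k ihk =>
        rw [pow_succ, ihk, hBdef, pow_succ]
        calc Uᴴ * A ^ k * U * (Uᴴ * A * U) = Uᴴ * A ^ k * (U * Uᴴ) * A * U := by
              simp only [Matrix.mul_assoc]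
          _ = _ := by rw [hU']; simp only [Matrix.mul_assoc, Matrix.mul_one, Matrix.one_mul]
    have htr : ∀ k, (B ^ k).trace = (A ^ k).trace := by
      intro k
      rw [hpow, Matrix.trace_mul_comm, ← Matrix.mul_assoc, hU', Matrix.one_mul]
    have hfro : (∑ i, ∑ j, ‖B i j‖ ^ 2 : ℝ) = ∑ i, ∑ j, ‖A i j‖ ^ 2 := by
      have : (Bᴴ * B).trace = (Aᴴ * A).trace := by
        have e : Bᴴ * B = Uᴴ * (Aᴴ * A) * U := by
          rw [hBdef]
          simp only [Matrix.conjTranspose_mul, Matrix.conjTranspose_conjTranspose]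
          calc Uᴴ * (Aᴴ * U) * (Uᴴ * A * U) = Uᴴ * Aᴴ * (U * Uᴴ) * A * U := by
                simp only [Matrix.mul_assoc]
            _ = _ := by rw [hU']; simp only [Matrix.mul_assoc, Matrix.mul_one, Matrix.one_mul]
        rw [e, Matrix.trace_mul_comm, ← Matrix.mul_assoc, hU', Matrix.one_mul]
      rw [aux_fro, aux_fro] at this
      exact_mod_cast this
    have hchar : B.charpoly = A.charpoly := by
      let V : (Matrix (Fin (n+1)) (Fin (n+1)) ℂ)ˣ := ⟨Uᴴ, U, hU, hU'⟩
      have h := Matrix.charpoly_units_conj V A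
      rwa [show ((V : Matrix (Fin (n+1)) (Fin (n+1)) ℂ))⁻¹ = U from Matrix.inv_eq_right_inv hU] at h
    obtain ⟨v, hv1, hv2, hv3⟩ := ih (B.submatrix Fin.succ Fin.succ)
    refine ⟨Fin.cons (B 0 0) v, ?_, ?_, fun k => ?_⟩
    · rw [← hchar, aux_blk_charpoly B hB, Polynomial.roots_mul, hv1, Polynomial.roots_X_sub_C]
      · rw [Fin.univ_succ]
        simp [Multiset.map_map]
      · exact mul_ne_zero (Polynomial.X_sub_C_ne_zero _) (Matrix.charpoly_monic _).ne_zero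
    · rw [← hfro, Fin.sum_univ_succ, Fin.sum_univ_succ]
      simp only [Fin.cons_zero, Fin.cons_succ]
      refine add_le_add ?_ (hv2.trans ?_)
      · exact Finset.single_le_sum (f := fun j => ‖B 0 j‖ ^ 2) (fun j _ => by positivity)
          (Finset.mem_univ 0)
      · refine Finset.sum_le_sum fun i _ => ?_
        rw [Fin.sum_univ_succ]
        simp only [Matrix.submatrix_apply]
        linarith [sq_nonneg ‖B i.succ 0‖]
    · obtain ⟨-, q2, q3⟩ := aux_blk_pow B hB k
      rw [← htr, Fin.sum_univ_succ]
      simp only [Fin.cons_zero, Fin.cons_succ]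
      rw [← hv3, Matrix.trace, Fin.sum_univ_succ]
      simp [Matrix.trace, q2, q3]

theorem root_bound {n : ℕ} (A : Matrix (Fin n) (Fin n) ℂ) (K : ℝ)
    (hK : ∀ i, ∑ j, ‖A i j‖ ≤ K) (z : ℂ) (hz : z ∈ A.charpoly.roots) : ‖z‖ ≤ K := by
  have h1 : z ∈ spectrum ℂ A := by
    rw [Matrix.mem_spectrum_iff_isRoot_charpoly]
    exact Polynomial.isRoot_of_mem_roots hz
  have h2 : Module.End.HasEigenvalue (Matrix.toLin' A) z := by
    rw [Module.End.hasEigenvalue_iff_mem_spectrum, Matrix.spectrum_toLin']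
    exact h1
  obtain ⟨k, hk⟩ := eigenvalue_mem_ball h2
  rw [mem_closedBall_iff_norm] at hk
  calc ‖z‖ ≤ ‖A k k‖ + ‖z - A k k‖ := by
        have := norm_add_le (A k k) (z - A k k); simpa using this
    _ ≤ ‖A k k‖ + ∑ j ∈ Finset.univ.erase k, ‖A k j‖ := by gcongr
    _ = ∑ j, ‖A k j‖ := Finset.add_sum_erase _ (fun j => ‖A k j‖) (Finset.mem_univ k)
    _ ≤ K := hK k

end SchurPart


section AbstractPart
open MeasureTheory

/-- Fourier coefficients of `f^k`. -/
noncomputable def cft (f : ℝ → ℝ) (k : ℕ) (m : ℤ) : ℂ :=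
  ((1 / (2 * Real.pi) : ℝ) : ℂ) *
    ∫ θ in (-Real.pi)..Real.pi, ((f θ : ℝ) : ℂ) ^ k * Complex.exp (-(Complex.I * m * θ))

structure SymbolData (w t : ℤ → ℝ) (f : ℝ → ℝ) : Prop where
  w0 : ∀ m, 0 ≤ w m
  hw : Summable w
  tw : ∀ m, |t m| ≤ w m
  teven : ∀ m, t (-m) = t m
  hf : ∀ θ : ℝ, ((f θ : ℝ) : ℂ) = ∑' m : ℤ, (t m : ℂ) * Complex.exp (Complex.I * m * θ)

variable {w t : ℤ → ℝ} {f : ℝ → ℝ}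

lemma exp_norm_aux (m : ℤ) (θ : ℝ) : ‖Complex.exp (Complex.I * m * θ)‖ = 1 := by
  have := Complex.norm_exp_ofReal_mul_I (m * θ)
  rw [← this]; congr 2; push_cast; ring

lemma SymbolData.term_le (h : SymbolData w t f) (m : ℤ) (θ : ℝ) :
    ‖(t m : ℂ) * Complex.exp (Complex.I * m * θ)‖ ≤ w m := by
  rw [norm_mul, exp_norm_aux, mul_one, Complex.norm_real]; exact h.tw m

lemma SymbolData.hasSum (h : SymbolData w t f) (θ : ℝ) :
    HasSum (fun m : ℤ => (t m : ℂ) * Complex.exp (Complex.I * m * θ)) (f θ : ℂ) := by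
  rw [h.hf θ]
  exact (Summable.of_norm_bounded h.hw (fun m => h.term_le m θ)).hasSum

lemma SymbolData.B0 (h : SymbolData w t f) : 0 ≤ ∑' m, w m := tsum_nonneg h.w0

lemma SymbolData.f_le (h : SymbolData w t f) (θ : ℝ) : |f θ| ≤ ∑' m, w m := by
  have := tsum_of_norm_bounded h.hw.hasSum (fun m => h.term_le m θ)
  rw [← h.hf θ, Complex.norm_real] at this
  exact this

lemma SymbolData.cont (h : SymbolData w t f) : Continuous f := by
  have : Continuous fun θ : ℝ => ((f θ : ℝ) : ℂ) := by
    simp_rw [h.hf]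
    exact continuous_tsum (fun m => by fun_prop) h.hw (fun m θ => h.term_le m θ)
  exact Complex.continuous_re.comp this

lemma exp_norm_aux' (m : ℤ) (θ : ℝ) : ‖Complex.exp (-(Complex.I * m * θ))‖ = 1 := by
  have := exp_norm_aux (-m) θ
  rw [← this]; congr 2; push_cast; ring

lemma SymbolData.c_le (h : SymbolData w t f) (k : ℕ) (m : ℤ) :
    ‖cft f k m‖ ≤ (∑' m, w m) ^ k := by
  have h1 : ‖∫ θ in (-Real.pi)..Real.pi, ((f θ : ℝ) : ℂ) ^ k * Complex.exp (-(Complex.I * m * θ))‖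
      ≤ (∑' m, w m) ^ k * |Real.pi - -Real.pi| := by
    apply intervalIntegral.norm_integral_le_of_norm_le_const
    intro θ _
    rw [norm_mul, exp_norm_aux', mul_one, norm_pow, Complex.norm_real]
    exact pow_le_pow_left₀ (norm_nonneg _) (h.f_le θ) k
  have hpi := Real.pi_pos
  rw [cft, norm_mul, Complex.norm_real, Real.norm_of_nonneg (by positivity)]
  rw [abs_of_pos (by linarith)] at h1
  calc _ ≤ 1 / (2 * Real.pi) * ((∑' m, w m) ^ k * (Real.pi - -Real.pi)) := by gcongr
    _ = _ := by field_simp; ring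

lemma SymbolData.c_zero (h : SymbolData w t f) (m : ℤ) : cft f 0 m = if m = 0 then 1 else 0 := by
  have hpi := Real.pi_pos
  simp only [cft, pow_zero, one_mul]
  split_ifs with hm
  · subst hm
    simp only [Int.cast_zero, mul_zero, zero_mul, neg_zero, Complex.exp_zero,
      intervalIntegral.integral_const]
    simp
    field_simp
    norm_num
  · have hc : (-(Complex.I * m) : ℂ) ≠ 0 := by
      simp [Complex.I_ne_zero, hm]
    have := integral_exp_mul_complex (a := -Real.pi) (b := Real.pi) hc
    have e : (fun θ : ℝ => Complex.exp (-(Complex.I * m * θ)))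
        = fun θ : ℝ => Complex.exp (-(Complex.I * m) * θ) := by ext θ; ring_nf
    rw [e, this]
    have e2 : Complex.exp (-(Complex.I * m) * (Real.pi : ℝ))
        = Complex.exp (-(Complex.I * m) * ((-Real.pi : ℝ))) := by
      rw [Complex.exp_eq_exp_iff_exists_int]
      exact ⟨-m, by push_cast; ring⟩
    rw [e2]; simp

lemma SymbolData.c_rec (h : SymbolData w t f) (k : ℕ) (m : ℤ) :
    HasSum (fun l : ℤ => (t l : ℂ) * cft f k (m - l)) (cft f (k+1) m) := by
  have hc := h.cont
  have key : HasSum (fun l : ℤ => ∫ θ in (-Real.pi)..Real.pi,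
      ((t l : ℂ) * Complex.exp (Complex.I * l * θ)) *
        (((f θ : ℝ) : ℂ) ^ k * Complex.exp (-(Complex.I * m * θ))))
      (∫ θ in (-Real.pi)..Real.pi, ((f θ : ℝ) : ℂ) ^ (k+1) * Complex.exp (-(Complex.I * m * θ))) := by
    apply intervalIntegral.hasSum_integral_of_dominated_convergence
      (bound := fun l _ => w l * (∑' m, w m) ^ k)
    · intro l
      apply Continuous.aestronglyMeasurable
      fun_prop
    · intro l
      refine Filter.Eventually.of_forall fun θ _ => ?_
      rw [norm_mul]
      gcongr
      · exact h.w0 l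
      · exact h.term_le l θ
      · rw [norm_mul, exp_norm_aux', mul_one, norm_pow, Complex.norm_real]
        exact pow_le_pow_left₀ (norm_nonneg _) (h.f_le θ) k
    · exact Filter.Eventually.of_forall fun θ _ => h.hw.mul_right _
    · exact intervalIntegrable_const
    · refine Filter.Eventually.of_forall fun θ _ => ?_
      have := (h.hasSum θ).mul_right (((f θ : ℝ) : ℂ) ^ k * Complex.exp (-(Complex.I * m * θ)))
      have e : ((f θ : ℝ) : ℂ) ^ (k+1) * Complex.exp (-(Complex.I * m * θ))
        = (f θ : ℂ) * (((f θ : ℝ) : ℂ) ^ k * Complex.exp (-(Complex.I * m * θ))) := by ring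
      rw [e]; exact this
  have := key.mul_left ((1 / (2 * Real.pi) : ℝ) : ℂ)
  refine (congrArg (fun g : ℤ → ℂ => HasSum g (cft f (k+1) m)) (funext fun l => ?_)).mpr this
  rw [cft, mul_left_comm, ← intervalIntegral.integral_const_mul]
  congr 1
  congr 1
  ext θ
  have e : Complex.exp (-(Complex.I * ((m - l : ℤ) : ℂ) * θ))
      = Complex.exp (Complex.I * l * θ) * Complex.exp (-(Complex.I * m * θ)) := by
    rw [← Complex.exp_add]; congr 1; push_cast; ring
  rw [e]; ring

lemma SymbolData.c_rec' (h : SymbolData w t f) (k : ℕ) (i j : ℤ) :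
    HasSum (fun l : ℤ => (t (i - l) : ℂ) * cft f k (l - j)) (cft f (k+1) (i - j)) := by
  have := h.c_rec k (i - j)
  rw [← (Equiv.subLeft i).hasSum_iff] at this
  convert this using 1
  ext l
  simp only [Function.comp, Equiv.subLeft_apply]
  congr 2
  ring

/-- extension of a row by zero -/
noncomputable def rext {N : ℕ} (A : Matrix (Fin N) (Fin N) ℂ) (i : Fin N) : ℤ → ℂ :=
  Function.extend (fun l : Fin N => ((l : ℕ) : ℤ)) (A i) 0

lemma fin_inj (N : ℕ) : Function.Injective (fun l : Fin N => ((l : ℕ) : ℤ)) := by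
  intro a b hab
  ext
  simpa using hab

lemma rext_apply {N : ℕ} (A : Matrix (Fin N) (Fin N) ℂ) (i l : Fin N) :
    rext A i ((l : ℕ) : ℤ) = A i l := (fin_inj N).extend_apply (A i) 0 l

lemma rext_le {N : ℕ} (w0 : ∀ m, 0 ≤ w m) (A : Matrix (Fin N) (Fin N) ℂ)
    (hA : ∀ i j : Fin N, ‖A i j‖ ≤ w ((i : ℕ) - (j : ℕ))) (i : Fin N) (l : ℤ) :
    ‖rext A i l‖ ≤ w ((i : ℕ) - l) := by
  by_cases hl : ∃ a : Fin N, ((a : ℕ) : ℤ) = l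
  · obtain ⟨a, rfl⟩ := hl
    rw [rext_apply]; exact hA i a
  · rw [rext, Function.extend_apply' _ _ _ hl]
    simpa using w0 _

lemma rext_hasSum {N : ℕ} (A : Matrix (Fin N) (Fin N) ℂ) (i : Fin N) (g : ℤ → ℂ) :
    HasSum (fun l : ℤ => rext A i l * g l) (∑ l : Fin N, A i l * g ((l : ℕ) : ℤ)) := by
  rw [← (fin_inj N).hasSum_iff]
  · convert hasSum_fintype _
    simp [rext_apply]
  · intro x hx
    rw [rext, Function.extend_apply' _ _ _ hx]
    simp

/-- row error -/
noncomputable def rerr (t : ℤ → ℝ) {N : ℕ} (A : Matrix (Fin N) (Fin N) ℂ) (i : Fin N) : ℝ :=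
  ∑' l : ℤ, ‖rext A i l - t ((i : ℕ) - l)‖

lemma sub_summable (hw : Summable w) (i : ℤ) : Summable fun l : ℤ => w (i - l) :=
  (Equiv.subLeft i).summable_iff.2 hw

lemma sub_tsum (w : ℤ → ℝ) (i : ℤ) : ∑' l : ℤ, w (i - l) = ∑' m, w m :=
  (Equiv.subLeft i).tsum_eq w

lemma SymbolData.rerr_summable (h : SymbolData w t f) {N : ℕ} (A : Matrix (Fin N) (Fin N) ℂ)
    (hA : ∀ i j : Fin N, ‖A i j‖ ≤ w ((i : ℕ) - (j : ℕ))) (i : Fin N) :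
    (∀ l : ℤ, ‖rext A i l - t ((i : ℕ) - l)‖ ≤ 2 * w ((i : ℕ) - l)) ∧
    Summable fun l : ℤ => ‖rext A i l - t ((i : ℕ) - l)‖ := by
  have h1 : ∀ l : ℤ, ‖rext A i l - t ((i : ℕ) - l)‖ ≤ 2 * w ((i : ℕ) - l) := by
    intro l
    have a1 := rext_le h.w0 A hA i l
    have a2 := h.tw ((i : ℕ) - l)
    calc _ ≤ ‖rext A i l‖ + ‖(t ((i : ℕ) - l) : ℂ)‖ := norm_sub_le _ _
      _ ≤ _ := by rw [Complex.norm_real, Real.norm_eq_abs]; linarith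
  exact ⟨h1, Summable.of_nonneg_of_le (fun _ => norm_nonneg _) h1 ((sub_summable h.hw _).mul_left 2)⟩

lemma SymbolData.rowsum (h : SymbolData w t f) (N : ℕ) (i : ℤ) :
    ∑ l : Fin N, w (i - ((l : ℕ) : ℤ)) ≤ ∑' m, w m := by
  rw [← sub_tsum w i]
  have := Summable.sum_le_tsum (f := fun l : ℤ => w (i - l))
    (Finset.univ.map ⟨_, fin_inj N⟩) (fun _ _ => h.w0 _) (sub_summable h.hw i)
  simpa using this

lemma SymbolData.colsum (h : SymbolData w t f) (N : ℕ) (i : ℤ) :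
    ∑ l : Fin N, w (((l : ℕ) : ℤ) - i) ≤ ∑' m, w m := by
  rw [← (Equiv.subRight i).tsum_eq w]
  have := Summable.sum_le_tsum (f := fun l : ℤ => w (l - i))
    (Finset.univ.map ⟨_, fin_inj N⟩) (fun _ _ => h.w0 _) ((Equiv.subRight i).summable_iff.2 h.hw)
  simpa using this

lemma SymbolData.pow_err (h : SymbolData w t f) (k : ℕ) : ∃ C : ℝ, 0 ≤ C ∧
    ∀ (N : ℕ) (A : Matrix (Fin N) (Fin N) ℂ)
    (_ : ∀ i j : Fin N, ‖A i j‖ ≤ w ((i : ℕ) - (j : ℕ))),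
    ∃ d : Fin N → ℝ, (∀ i j : Fin N, ‖(A ^ k) i j - cft f k ((i : ℕ) - (j : ℕ))‖ ≤ d i) ∧
      ∑ i, d i ≤ C * ∑ i, rerr t A i := by
  induction k with
  | zero =>
    refine ⟨0, le_rfl, fun N A hA => ⟨fun _ => 0, fun i j => ?_, by simp⟩⟩
    rw [h.c_zero]
    simp only [pow_zero, Matrix.one_apply, sub_eq_zero, Fin.ext_iff, Nat.cast_inj]
    simp
  | succ k ih =>
    obtain ⟨C, hC, ih⟩ := ih
    set B := ∑' m, w m with hB
    have hB0 : 0 ≤ B := h.B0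
    refine ⟨B * C + B ^ k, by positivity, fun N A hA => ?_⟩
    obtain ⟨d, hd, hds⟩ := ih N A hA
    refine ⟨fun i => ∑ l : Fin N, w ((i : ℕ) - (l : ℕ)) * d l + B ^ k * rerr t A i,
      fun i j => ?_, ?_⟩
    · have d0 : ∀ l, 0 ≤ d l := fun l => (norm_nonneg _).trans (hd l j)
      have e1 : (A ^ (k+1)) i j - cft f (k+1) ((i : ℕ) - (j : ℕ))
          = ∑ l : Fin N, A i l * ((A ^ k) l j - cft f k ((l : ℕ) - (j : ℕ)))
            + ∑' l : ℤ, (rext A i l - t ((i : ℕ) - l)) * cft f k (l - (j : ℕ)) := by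
        have s1 := rext_hasSum A i (fun l => cft f k (l - (j : ℕ)))
        have s2 := h.c_rec' k (i : ℕ) (j : ℕ)
        have s3 := s1.sub s2
        simp_rw [← sub_mul] at s3
        rw [s3.tsum_eq, pow_succ', Matrix.mul_apply]
        simp_rw [mul_sub]
        rw [Finset.sum_sub_distrib]
        ring
      rw [e1]
      refine (norm_add_le _ _).trans (add_le_add ?_ ?_)
      · refine (norm_sum_le _ _).trans (Finset.sum_le_sum fun l _ => ?_)
        rw [norm_mul]
        exact mul_le_mul (hA i l) (hd l j) (norm_nonneg _) (h.w0 _)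
      · rw [rerr, ← tsum_mul_left]
        refine tsum_of_norm_bounded (((h.rerr_summable A hA i).2.mul_left _).hasSum) fun l => ?_
        rw [norm_mul, mul_comm]
        exact mul_le_mul_of_nonneg_right (h.c_le k _) (norm_nonneg _)
    · rcases isEmpty_or_nonempty (Fin N) with hN | hN
      · simp
      have d0 : ∀ l, 0 ≤ d l := fun l => (norm_nonneg _).trans (hd l (Classical.arbitrary _))
      rw [Finset.sum_add_distrib, Finset.sum_comm, ← Finset.mul_sum, add_mul]
      gcongr
      calc _ = ∑ l : Fin N, (∑ i : Fin N, w ((i : ℕ) - (l : ℕ))) * d l := by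
            simp_rw [Finset.sum_mul]
        _ ≤ ∑ l : Fin N, B * d l := Finset.sum_le_sum fun l _ =>
            mul_le_mul_of_nonneg_right (h.colsum N _) (d0 l)
        _ = B * ∑ l, d l := by rw [Finset.mul_sum]
        _ ≤ B * (C * ∑ i, rerr t A i) := by gcongr
        _ = _ := by ring

end AbstractPart


section AbstractPart2
open MeasureTheory

variable {w t : ℤ → ℝ} {f : ℝ → ℝ}

lemma count_low (N a : ℕ) : ∑ i : Fin N, (if (i : ℕ) < a then (1:ℝ) else 0) ≤ a := by
  rw [Finset.sum_ite, Finset.sum_const_zero, add_zero, Finset.sum_const, nsmul_eq_mul, mul_one]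
  have : (Finset.univ.filter fun i : Fin N => (i : ℕ) < a).card ≤ (Finset.range a).card := by
    apply Finset.card_le_card_of_injOn (fun i : Fin N => (i : ℕ))
    · intro i hi; simpa using hi
    · intro i _ j _ hij; exact Fin.ext hij
  rw [Finset.card_range] at this
  exact_mod_cast this

lemma count_high (N a : ℕ) : ∑ i : Fin N, (if N ≤ (i : ℕ) + a then (1:ℝ) else 0) ≤ a := by
  refine le_trans (le_of_eq ?_) (count_low N a)
  rw [← Equiv.sum_comp Fin.revPerm]
  refine Finset.sum_congr rfl fun i _ => ?_
  simp only [Fin.revPerm_apply, Fin.val_rev]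
  have := i.2
  congr 1
  apply propext
  constructor <;> intro _ <;> omega

/-- the class of matrices -/
structure MatData (w t : ℤ → ℝ) (q : ℕ) {N : ℕ} (M : Matrix (Fin N) (Fin N) ℝ) : Prop where
  le : ∀ i j : Fin N, |M i j| ≤ w ((i : ℕ) - (j : ℕ))
  eq : ∀ i j : Fin N, q ≤ (i : ℕ) → q ≤ (j : ℕ) → (i : ℕ) + q < N → (j : ℕ) + q < N →
    M i j = t ((i : ℕ) - (j : ℕ))

/-- complexification -/
noncomputable abbrev cx {N : ℕ} (M : Matrix (Fin N) (Fin N) ℝ) : Matrix (Fin N) (Fin N) ℂ :=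
  M.map (fun x => (x : ℂ))

lemma MatData.cle {q N : ℕ} {M : Matrix (Fin N) (Fin N) ℝ} (hM : MatData w t q M) (i j : Fin N) :
    ‖cx M i j‖ ≤ w ((i : ℕ) - (j : ℕ)) := by
  simpa using hM.le i j

lemma SymbolData.err_sum (h : SymbolData w t f) (q : ℕ) (ε : ℝ) (hε : 0 < ε) : ∃ K : ℝ,
    ∀ (N : ℕ) (M : Matrix (Fin N) (Fin N) ℝ), MatData w t q M →
      ∑ i, rerr t (cx M) i ≤ ε * N + K := by
  set B := ∑' m, w m with hB
  have hB0 : 0 ≤ B := h.B0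
  have h1 := tendsto_tsum_compl_atTop_zero w
  have h2 := (h1.eventually (gt_mem_nhds (half_pos hε))).exists
  obtain ⟨s, hs⟩ := h2
  obtain ⟨R, hR⟩ : ∃ R : ℕ, ∀ m ∈ s, |m| ≤ R := by
    refine ⟨∑ m ∈ s, m.natAbs, fun m hm => ?_⟩
    have := Finset.single_le_sum (f := fun m : ℤ => m.natAbs) (fun _ _ => Nat.zero_le _) hm
    rw [Int.abs_eq_natAbs]
    exact_mod_cast this
  refine ⟨2 * B * (2 * (q + R + 1 : ℕ)), fun N M hM => ?_⟩
  have key : ∀ i : Fin N, rerr t (cx M) i ≤ ε + 2 * B * ((if (i : ℕ) < q + R + 1 then (1:ℝ) else 0)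
      + (if N ≤ (i : ℕ) + (q + R + 1) then (1:ℝ) else 0)) := by
    intro i
    obtain ⟨b1, b2⟩ := h.rerr_summable (cx M) hM.cle i
    have gen : rerr t (cx M) i ≤ 2 * B := by
      rw [rerr, hB, ← sub_tsum w (i : ℕ), ← tsum_mul_left]
      exact Summable.tsum_le_tsum b1 b2 ((sub_summable h.hw _).mul_left 2)
    by_cases c1 : (i : ℕ) < q + R + 1
    · rw [if_pos c1]
      have : (0:ℝ) ≤ if N ≤ (i : ℕ) + (q + R + 1) then (1:ℝ) else 0 := by split_ifs <;> norm_num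
      nlinarith
    by_cases c2 : N ≤ (i : ℕ) + (q + R + 1)
    · rw [if_neg c1, if_pos c2]; linarith
    rw [if_neg c1, if_neg c2, add_zero, mul_zero, add_zero]
    have e1 : ∀ l : ℤ, ‖rext (cx M) i l - t ((i : ℕ) - l)‖
        ≤ 2 * ((s : Set ℤ)ᶜ).indicator w ((i : ℕ) - l) := by
      intro l
      by_cases hl : ((i : ℕ) - l : ℤ) ∈ s
      · have := abs_le.1 (hR _ hl)
        obtain ⟨a, rfl⟩ : ∃ a : ℕ, l = a := ⟨l.toNat, by omega⟩
        have ha : a < N := by omega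
        have r := rext_apply (cx M) i ⟨a, ha⟩
        simp only at r
        rw [r]
        have := hM.eq i ⟨a, ha⟩ (by omega) (by simp only; omega) (by omega) (by simp only; omega)
        simp only at this
        simp [hl, this]
      · rw [Set.indicator_of_mem (by simpa using hl)]
        exact b1 l
    have e2 : Summable (((s : Set ℤ)ᶜ).indicator w) := h.hw.indicator _
    calc rerr t (cx M) i ≤ ∑' l : ℤ, 2 * ((s : Set ℤ)ᶜ).indicator w ((i : ℕ) - l) :=
          Summable.tsum_le_tsum e1 b2 ((sub_summable e2 _).mul_left 2)
      _ = 2 * ∑' a : {x // x ∉ s}, w a := by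
          rw [tsum_mul_left, sub_tsum]
          congr 1
          exact (tsum_subtype ((s : Set ℤ)ᶜ) w).symm
      _ ≤ ε := by linarith
  calc _ ≤ ∑ i : Fin N, (ε + 2 * B * ((if (i : ℕ) < q + R + 1 then (1:ℝ) else 0)
      + (if N ≤ (i : ℕ) + (q + R + 1) then (1:ℝ) else 0))) := Finset.sum_le_sum fun i _ => key i
    _ = ε * N + 2 * B * (∑ i : Fin N, (if (i : ℕ) < q + R + 1 then (1:ℝ) else 0)
      + ∑ i : Fin N, (if N ≤ (i : ℕ) + (q + R + 1) then (1:ℝ) else 0)) := by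
        rw [Finset.sum_add_distrib, ← Finset.mul_sum, Finset.sum_add_distrib]
        simp [mul_comm]
    _ ≤ _ := by
        have := count_low N (q + R + 1)
        have := count_high N (q + R + 1)
        gcongr
        linarith

lemma SymbolData.err_tendsto (h : SymbolData w t f) (q : ℕ) (Nn : ℕ → ℕ)
    (hN : Filter.Tendsto Nn Filter.atTop Filter.atTop)
    (M : ∀ n, Matrix (Fin (Nn n)) (Fin (Nn n)) ℝ) (hM : ∀ᶠ n in Filter.atTop, MatData w t q (M n)) :
    Filter.Tendsto (fun n => (∑ i, rerr t (cx (M n)) i) / (Nn n : ℝ)) Filter.atTop (nhds 0) := by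
  rw [Metric.tendsto_nhds]
  intro ε hε
  obtain ⟨K, hK⟩ := h.err_sum q (ε / 2) (half_pos hε)
  have h2 : Filter.Tendsto (fun n => (Nn n : ℝ)) Filter.atTop Filter.atTop :=
    tendsto_natCast_atTop_atTop.comp hN
  filter_upwards [hM, h2.eventually_gt_atTop (2 * K / ε), h2.eventually_gt_atTop 0] with n a b c
  have := hK _ _ a
  have nn : 0 ≤ ∑ i, rerr t (cx (M n)) i :=
    Finset.sum_nonneg fun i _ => tsum_nonneg fun _ => norm_nonneg _
  rw [Real.dist_eq, sub_zero, abs_of_nonneg (by positivity), div_lt_iff₀ c]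
  rw [div_lt_iff₀ hε] at b
  linarith

lemma SymbolData.im_bound (h : SymbolData w t f) {q N : ℕ} {M : Matrix (Fin N) (Fin N) ℝ}
    (hM : MatData w t q M) (v : Fin N → ℂ)
    (h2 : ∑ i, ‖v i‖ ^ 2 ≤ ∑ i, ∑ j, ‖cx M i j‖ ^ 2)
    (h3 : ((cx M) ^ 2).trace = ∑ i, v i ^ 2) :
    ∑ i, (v i).im ^ 2 ≤ (∑' m, w m) * ∑ i, rerr t (cx M) i := by
  set B := ∑' m, w m with hB
  have e1 : ∑ i, (v i).im ^ 2 = (∑ i, ‖v i‖ ^ 2 - (∑ i, v i ^ 2).re) / 2 := by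
    rw [Complex.re_sum, ← Finset.sum_sub_distrib, Finset.sum_div]
    refine Finset.sum_congr rfl fun i _ => ?_
    rw [← Complex.normSq_eq_norm_sq, Complex.normSq_apply, pow_two (v i), Complex.mul_re]
    ring
  have e2 : (((cx M) ^ 2).trace).re = ∑ i, ∑ j, M i j * M j i := by
    rw [pow_two, Matrix.trace, Complex.re_sum]
    refine Finset.sum_congr rfl fun i _ => ?_
    rw [Matrix.diag, Matrix.mul_apply, Complex.re_sum]
    refine Finset.sum_congr rfl fun j _ => ?_
    simp
  have e3 : ∑ i, ∑ j, ‖cx M i j‖ ^ 2 - ∑ i, ∑ j, M i j * M j i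
      = (∑ i, ∑ j, (M i j - M j i) ^ 2) / 2 := by
    have : ∑ i, ∑ j, (M i j - M j i) ^ 2
        = ∑ i, ∑ j, M i j ^ 2 + ∑ i, ∑ j, M j i ^ 2 - 2 * ∑ i, ∑ j, M i j * M j i := by
      simp_rw [Finset.mul_sum, ← Finset.sum_add_distrib, ← Finset.sum_sub_distrib]
      refine Finset.sum_congr rfl fun i _ => Finset.sum_congr rfl fun j _ => ?_
      ring
    rw [this, Finset.sum_comm (f := fun i j => M j i ^ 2)]
    simp
    ring
  have wB : ∀ m, w m ≤ B := fun m => h.hw.le_tsum m (fun j _ => h.w0 j)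
  have r1 : ∀ i, ∑ j : Fin N, |M i j - t ((i : ℕ) - (j : ℕ))| ≤ rerr t (cx M) i := by
    intro i
    have := Summable.sum_le_tsum (f := fun l : ℤ => ‖rext (cx M) i l - t ((i : ℕ) - l)‖)
      (Finset.univ.map ⟨_, fin_inj N⟩) (fun _ _ => norm_nonneg _) (h.rerr_summable (cx M) hM.cle i).2
    refine le_trans (le_of_eq ?_) this
    rw [Finset.sum_map]
    refine Finset.sum_congr rfl fun j _ => ?_
    simp only [Function.Embedding.coeFn_mk]
    rw [rext_apply, show cx M i j = ((M i j : ℝ) : ℂ) from rfl, ← Complex.ofReal_sub, Complex.norm_real, Real.norm_eq_abs]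
  have e4 : ∑ i, ∑ j, (M i j - M j i) ^ 2 ≤ 2 * B * (2 * ∑ i, rerr t (cx M) i) := by
    calc ∑ i, ∑ j, (M i j - M j i) ^ 2
        ≤ ∑ i : Fin N, ∑ j : Fin N, 2 * B * (|M i j - t ((i : ℕ) - (j : ℕ))| + |M j i - t ((j : ℕ) - (i : ℕ))|) := by
          refine Finset.sum_le_sum fun i _ => Finset.sum_le_sum fun j _ => ?_
          have a1 : |M i j - M j i| ≤ 2 * B := by
            have := abs_sub (M i j) (M j i)
            have := (hM.le i j).trans (wB _)
            have := (hM.le j i).trans (wB _)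
            linarith
          have a2 : |M i j - M j i| ≤ |M i j - t ((i : ℕ) - (j : ℕ))| + |M j i - t ((j : ℕ) - (i : ℕ))| := by
            have : t ((j : ℕ) - (i : ℕ)) = t ((i : ℕ) - (j : ℕ)) := by
              rw [← h.teven]; congr 1; ring
            rw [this, abs_sub_comm (M j i)]
            exact abs_sub_le _ _ _
          rw [← sq_abs, pow_two]
          exact mul_le_mul a1 a2 (abs_nonneg _) ((abs_nonneg _).trans a1)
      _ = 2 * B * (2 * ∑ i : Fin N, ∑ j : Fin N, |M i j - t ((i : ℕ) - (j : ℕ))|) := by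
          simp_rw [← Finset.mul_sum, Finset.sum_add_distrib]
          rw [Finset.sum_comm (f := fun i j : Fin N => |M j i - t ((j : ℕ) - (i : ℕ))|)]
          ring
      _ ≤ _ := by
          have := h.B0
          gcongr with i
          exact r1 i
  rw [e1, ← h3, e2]
  linarith

end AbstractPart2


section AbstractPart3
open MeasureTheory Filter Topology

variable {w t : ℤ → ℝ} {f : ℝ → ℝ}

lemma pow_sub_bound (B : ℝ) (z x : ℂ) (hz : ‖z‖ ≤ B) (hx : ‖x‖ ≤ B) (k : ℕ) :
    ‖z ^ k - x ^ k‖ ≤ k * B ^ (k - 1) * ‖z - x‖ := by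
  have hB : 0 ≤ B := (norm_nonneg _).trans hz
  rw [← Commute.geom_sum₂_mul (Commute.all z x), norm_mul]
  gcongr
  refine (norm_sum_le _ _).trans ?_
  calc _ ≤ ∑ i ∈ Finset.range k, B ^ (k - 1) := by
        refine Finset.sum_le_sum fun i hi => ?_
        rw [norm_mul, norm_pow, norm_pow]
        have hi' := Finset.mem_range.1 hi
        calc _ ≤ B ^ i * B ^ (k - 1 - i) := by gcongr
          _ = B ^ (k - 1) := by rw [← pow_add]; congr 1; omega
    _ = _ := by simp

/-- data about asymptotic arrays of points -/
structure ArrData (B : ℝ) (f : ℝ → ℝ) (Nn : ℕ → ℕ) (v : ∀ n, Fin (Nn n) → ℂ) : Prop where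
  hB : 0 ≤ B
  fc : Continuous f
  fB : ∀ θ, |f θ| ≤ B
  hN : Tendsto Nn atTop atTop
  vB : ∀ᶠ n in atTop, ∀ i, ‖v n i‖ ≤ B
  im : Tendsto (fun n => (∑ i, |(v n i).im|) / (Nn n : ℝ)) atTop (𝓝 0)
  mom : ∀ k : ℕ, Tendsto (fun n => (∑ i, (v n i) ^ k) / (Nn n : ℂ)) atTop (𝓝 (cft f k 0))

variable {B : ℝ} {Nn : ℕ → ℕ} {v : ∀ n, Fin (Nn n) → ℂ}

/-- real mean -/
noncomputable def rmean (f : ℝ → ℝ) (G : ℝ → ℝ) : ℝ :=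
  1 / (2 * Real.pi) * ∫ θ in (-Real.pi)..Real.pi, G (f θ)

lemma cft_zero_eq (f : ℝ → ℝ) (k : ℕ) : cft f k 0 = ((rmean f (fun x => x ^ k) : ℝ) : ℂ) := by
  rw [cft, rmean, Complex.ofReal_mul, ← intervalIntegral.integral_ofReal]
  simp

lemma ArrData.remom (h : ArrData B f Nn v) (k : ℕ) :
    Tendsto (fun n => (∑ i, (v n i).re ^ k) / (Nn n : ℝ)) atTop (𝓝 (rmean f (fun x => x ^ k))) := by
  have h1 := (Complex.continuous_re.tendsto _).comp (h.mom k)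
  rw [cft_zero_eq, Complex.ofReal_re] at h1
  have h2 : Tendsto (fun n => (∑ i, (v n i).re ^ k) / (Nn n : ℝ)
      - (∑ i, ((v n i) ^ k).re) / (Nn n : ℝ)) atTop (𝓝 0) := by
    have h3 := h.im.const_mul (k * B ^ (k - 1))
    rw [mul_zero] at h3
    refine squeeze_zero_norm' ?_ h3
    filter_upwards [h.vB] with n hn
    rw [← sub_div, ← Finset.sum_sub_distrib, norm_div, Real.norm_natCast, ← mul_div_assoc]
    gcongr
    rw [Finset.mul_sum]
    refine (norm_sum_le _ _).trans (Finset.sum_le_sum fun i _ => ?_)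
    have a := pow_sub_bound B (v n i) ((v n i).re : ℂ) (hn i)
      (by rw [Complex.norm_real]; exact (Complex.abs_re_le_norm _).trans (hn i)) k
    have b : ‖v n i - ((v n i).re : ℂ)‖ = |(v n i).im| := by
      have : v n i - ((v n i).re : ℂ) = (v n i).im * Complex.I := by
        apply Complex.ext <;> simp
      rw [this]; simp
    rw [b] at a
    refine le_trans ?_ a
    have := Complex.abs_re_le_norm ((v n i) ^ k - ((v n i).re : ℂ) ^ k)
    refine le_trans (le_of_eq ?_) this
    rw [Complex.sub_re, ← Complex.ofReal_pow, Complex.ofReal_re, Real.norm_eq_abs, abs_sub_comm]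
  have h4 := h2.add h1
  rw [zero_add] at h4
  refine h4.congr fun n => ?_
  simp only [Function.comp]
  have : ((∑ i, (v n i) ^ k) / (Nn n : ℂ)).re = (∑ i, ((v n i) ^ k).re) / (Nn n : ℝ) := by
    rw [← Complex.re_sum, ← Complex.ofReal_natCast, Complex.div_ofReal_re]
  rw [this]; ring

lemma rmean_add (hf : Continuous f) (G H : ℝ → ℝ) (hG : Continuous G) (hH : Continuous H) :
    rmean f (fun x => G x + H x) = rmean f G + rmean f H := by
  rw [rmean, rmean, rmean, intervalIntegral.integral_add]
  · ring
  · exact (hG.comp hf).intervalIntegrable _ _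
  · exact (hH.comp hf).intervalIntegrable _ _

lemma rmean_smul (c : ℝ) (G : ℝ → ℝ) : rmean f (fun x => c * G x) = c * rmean f G := by
  rw [rmean, rmean, intervalIntegral.integral_const_mul]; ring

lemma ArrData.repoly (h : ArrData B f Nn v) (P : Polynomial ℝ) :
    Tendsto (fun n => (∑ i, P.eval (v n i).re) / (Nn n : ℝ)) atTop
      (𝓝 (rmean f (fun x => P.eval x))) := by
  induction P using Polynomial.induction_on' with
  | add P Q hP hQ =>
    simp_rw [Polynomial.eval_add, Finset.sum_add_distrib, add_div]
    rw [rmean_add h.fc _ _ P.continuous Q.continuous]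
    exact hP.add hQ
  | monomial k a =>
    simp_rw [Polynomial.eval_monomial, ← Finset.mul_sum, mul_div_assoc]
    rw [rmean_smul]
    exact (h.remom k).const_mul a

lemma rmean_close (hf : Continuous f) (hfB : ∀ θ, |f θ| ≤ B) (G H : ℝ → ℝ) (hG : Continuous G)
    (hH : Continuous H) (ε : ℝ) (hGH : ∀ x ∈ Set.Icc (-B) B, |G x - H x| ≤ ε) :
    |rmean f G - rmean f H| ≤ ε := by
  have hpi := Real.pi_pos
  have h1 : ‖∫ θ in (-Real.pi)..Real.pi, (G (f θ) - H (f θ))‖ ≤ ε * |Real.pi - -Real.pi| := by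
    apply intervalIntegral.norm_integral_le_of_norm_le_const
    intro θ _
    exact hGH _ (abs_le.1 (hfB θ))
  have i1 : IntervalIntegrable (fun θ => G (f θ)) volume (-Real.pi) Real.pi :=
    (hG.comp hf).intervalIntegrable _ _
  have i2 : IntervalIntegrable (fun θ => H (f θ)) volume (-Real.pi) Real.pi :=
    (hH.comp hf).intervalIntegrable _ _
  rw [intervalIntegral.integral_sub i1 i2, abs_of_pos (by linarith), Real.norm_eq_abs] at h1
  rw [rmean, rmean, ← mul_sub, abs_mul, abs_of_pos (by positivity)]
  calc _ ≤ 1 / (2 * Real.pi) * (ε * (Real.pi - -Real.pi)) := by gcongr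
    _ = ε := by field_simp; ring

lemma ArrData.recont (h : ArrData B f Nn v) (G : ℝ → ℝ) (hG : Continuous G) :
    Tendsto (fun n => (∑ i, G (v n i).re) / (Nn n : ℝ)) atTop (𝓝 (rmean f G)) := by
  rw [Metric.tendsto_nhds]
  intro ε hε
  obtain ⟨P, hP⟩ := exists_polynomial_near_of_continuousOn (-B) B G hG.continuousOn (ε / 4) (by positivity)
  have h1 := rmean_close h.fc h.fB (fun x => P.eval x) G P.continuous hG (ε / 4) (fun x hx => (hP x hx).le)
  have hpos := (h.hN.eventually_gt_atTop 0)
  filter_upwards [h.vB, Metric.tendsto_nhds.1 (h.repoly P) (ε / 4) (by positivity), hpos] with n a b c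
  rw [Real.dist_eq] at b ⊢
  have c' : (0:ℝ) < Nn n := by exact_mod_cast c
  have h2 : |(∑ i, G (v n i).re) / (Nn n : ℝ) - (∑ i, P.eval (v n i).re) / (Nn n : ℝ)| ≤ ε / 4 := by
    rw [← sub_div, ← Finset.sum_sub_distrib, abs_div, abs_of_pos c', div_le_iff₀ c']
    refine (Finset.abs_sum_le_sum_abs _ _).trans ?_
    calc _ ≤ ∑ i : Fin (Nn n), ε / 4 := Finset.sum_le_sum fun i _ => by
          rw [abs_sub_comm]
          exact (hP _ (abs_le.1 ((Complex.abs_re_le_norm _).trans (a i)))).le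
      _ = _ := by simp [mul_comm]
  rw [abs_le] at h1 h2
  rw [abs_lt] at b ⊢
  constructor <;> linarith

lemma ArrData.final (h : ArrData B f Nn v) (F : ℂ → ℂ) (hF : Continuous F) (hc : HasCompactSupport F) :
    Tendsto (fun n => (∑ i, F (v n i)) / (Nn n : ℂ)) atTop
      (𝓝 (((1 / (2 * Real.pi) : ℝ) : ℂ) * ∫ θ in (-Real.pi)..Real.pi, F ((f θ : ℝ) : ℂ))) := by
  have hu := hc.uniformContinuous_of_continuous hF
  have h1 : Tendsto (fun n => (∑ i, F (v n i)) / (Nn n : ℂ) - (∑ i, F ((v n i).re : ℂ)) / (Nn n : ℂ))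
      atTop (𝓝 0) := by
    obtain ⟨K, hK⟩ := hF.bounded_above_of_compact_support hc
    have hK0 : 0 ≤ K := (norm_nonneg _).trans (hK 0)
    rw [Metric.tendsto_nhds]
    intro ε hε
    obtain ⟨δ, hδ, hd⟩ := Metric.uniformContinuous_iff.1 hu (ε / 2) (half_pos hε)
    have h3 := h.im.const_mul (2 * K / δ)
    rw [mul_zero] at h3
    filter_upwards [Metric.tendsto_nhds.1 h3 (ε / 2) (half_pos hε),
      h.hN.eventually_gt_atTop 0] with n a c
    have c' : (0:ℝ) < Nn n := by exact_mod_cast c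
    rw [dist_zero_right] at a ⊢
    rw [← sub_div, ← Finset.sum_sub_distrib, norm_div, Complex.norm_natCast, div_lt_iff₀ c']
    have key : ∀ i, ‖F (v n i) - F ((v n i).re : ℂ)‖ ≤ ε / 2 + 2 * K / δ * |(v n i).im| := by
      intro i
      have e : dist (v n i) ((v n i).re : ℂ) = |(v n i).im| := by
        rw [dist_eq_norm]
        have : v n i - ((v n i).re : ℂ) = (v n i).im * Complex.I := by
          apply Complex.ext <;> simp
        rw [this]; simp
      by_cases hlt : |(v n i).im| < δ
      · have := hd (e.trans_lt hlt)
        rw [dist_eq_norm] at this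
        have : 0 ≤ 2 * K / δ * |(v n i).im| := by positivity
        linarith
      · have h5 : 2 * K ≤ 2 * K / δ * |(v n i).im| := by
          rw [div_mul_eq_mul_div, le_div_iff₀ hδ]
          exact mul_le_mul_of_nonneg_left (not_lt.1 hlt) (by positivity)
        have := norm_sub_le (F (v n i)) (F ((v n i).re : ℂ))
        have := hK (v n i)
        have := hK ((v n i).re : ℂ)
        linarith
    have a' := (le_abs_self _).trans_lt a
    rw [← mul_div_assoc, div_lt_iff₀ c'] at a'
    calc _ ≤ ∑ i, ‖F (v n i) - F ((v n i).re : ℂ)‖ := norm_sum_le _ _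
      _ ≤ ∑ i, (ε / 2 + 2 * K / δ * |(v n i).im|) := Finset.sum_le_sum fun i _ => key i
      _ = ε / 2 * Nn n + 2 * K / δ * ∑ i, |(v n i).im| := by
          rw [Finset.sum_add_distrib, ← Finset.mul_sum]; simp [mul_comm]
      _ < _ := by linarith
  have hG1 : Continuous fun x : ℝ => (F (x : ℂ)).re := by fun_prop
  have hG2 : Continuous fun x : ℝ => (F (x : ℂ)).im := by fun_prop
  have r1 := (Complex.continuous_ofReal.tendsto _).comp (h.recont _ hG1)
  have r2 := ((Complex.continuous_ofReal.tendsto _).comp (h.recont _ hG2)).mul_const Complex.I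
  have h6 := h1.add (r1.add r2)
  rw [zero_add] at h6
  have hlim : ((rmean f (fun x : ℝ => (F (x : ℂ)).re) : ℝ) : ℂ)
      + ((rmean f (fun x : ℝ => (F (x : ℂ)).im) : ℝ) : ℂ) * Complex.I
      = (((1 / (2 * Real.pi) : ℝ) : ℂ) * ∫ θ in (-Real.pi)..Real.pi, F ((f θ : ℝ) : ℂ)) := by
    rw [rmean, rmean, Complex.ofReal_mul, Complex.ofReal_mul, ← intervalIntegral.integral_ofReal,
      ← intervalIntegral.integral_ofReal, mul_assoc, ← mul_add, ← intervalIntegral.integral_mul_const,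
      ← intervalIntegral.integral_add]
    · simp only [Complex.re_add_im]
    · exact (Complex.continuous_ofReal.comp (hG1.comp h.fc)).intervalIntegrable _ _
    · exact ((Complex.continuous_ofReal.comp (hG2.comp h.fc)).mul continuous_const).intervalIntegrable _ _
  rw [← hlim]
  refine h6.congr fun n => ?_
  simp only [Function.comp]
  have : (∑ i, F ((v n i).re : ℂ)) / (Nn n : ℂ)
      = ((∑ i, (F ((v n i).re : ℂ)).re) / (Nn n : ℝ) : ℝ)
        + ((∑ i, (F ((v n i).re : ℂ)).im) / (Nn n : ℝ) : ℝ) * Complex.I := by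
    push_cast
    rw [div_mul_eq_mul_div, ← add_div, Finset.sum_mul, ← Finset.sum_add_distrib]
    simp only [Complex.re_add_im]
  rw [this]; ring

theorem abstract_main (h : SymbolData w t f) (q : ℕ) (Nn : ℕ → ℕ)
    (hN : Tendsto Nn atTop atTop)
    (M : ∀ n, Matrix (Fin (Nn n)) (Fin (Nn n)) ℝ) (hM : ∀ᶠ n in atTop, MatData w t q (M n))
    (F : ℂ → ℂ) (hF : Continuous F) (hc : HasCompactSupport F) :
    Tendsto (fun n => (1 / ((Nn n : ℕ) : ℂ)) *
      (((M n).map (fun x => (x : ℂ))).charpoly.roots.map F).sum) atTop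
      (𝓝 (((1 / (2 * Real.pi) : ℝ) : ℂ) * ∫ θ in (-Real.pi)..Real.pi, F ((f θ : ℝ) : ℂ))) := by
  choose v hv1 hv2 hv3 using fun n => schur_main (Nn n) (cx (M n))
  have herr := h.err_tendsto q Nn hN M hM
  have hA : ArrData (∑' m, w m) f Nn v := by
    refine ⟨h.B0, h.cont, h.f_le, hN, ?_, ?_, ?_⟩
    · filter_upwards [hM] with n hn i
      apply root_bound (cx (M n))
      · intro i
        exact (Finset.sum_le_sum fun j _ => hn.cle i j).trans (h.rowsum _ _)
      · rw [hv1]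
        exact Multiset.mem_map_of_mem _ (Finset.mem_univ i)
    · have h2 : Tendsto (fun n => (∑ i, (v n i).im ^ 2) / (Nn n : ℝ)) atTop (𝓝 0) := by
        have h3 := herr.const_mul (∑' m, w m)
        rw [mul_zero] at h3
        refine squeeze_zero' (Eventually.of_forall fun n => by positivity) ?_ h3
        filter_upwards [hM] with n hn
        rw [← mul_div_assoc]
        gcongr
        exact h.im_bound hn (v n) (hv2 n) (hv3 n 2)
      have h4 := h2.sqrt
      rw [Real.sqrt_zero] at h4
      refine squeeze_zero (fun n => by positivity) (fun n => ?_) h4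
      apply Real.le_sqrt_of_sq_le
      rcases Nat.eq_zero_or_pos (Nn n) with h0 | h0
      · simp [h0]
      have c' : (0:ℝ) < Nn n := by exact_mod_cast h0
      have := Finset.sum_mul_sq_le_sq_mul_sq Finset.univ (fun i => |(v n i).im|) (fun _ => (1:ℝ))
      simp only [mul_one, sq_abs, one_pow, Finset.sum_const, Finset.card_univ, Fintype.card_fin,
        nsmul_eq_mul] at this
      rw [div_pow, div_le_div_iff₀ (by positivity) c']
      nlinarith
    · intro k
      obtain ⟨C, hC, hp⟩ := h.pow_err k
      have h3 := herr.const_mul C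
      rw [mul_zero] at h3
      rw [tendsto_iff_norm_sub_tendsto_zero]
      refine squeeze_zero' (Eventually.of_forall fun n => norm_nonneg _) ?_ h3
      filter_upwards [hM, hN.eventually_gt_atTop 0] with n hn c
      have c' : (0:ℝ) < Nn n := by exact_mod_cast c
      have c'' : (Nn n : ℂ) ≠ 0 := by exact_mod_cast c.ne'
      obtain ⟨d, hd, hds⟩ := hp _ (cx (M n)) hn.cle
      have e : (∑ i, v n i ^ k) / (Nn n : ℂ) - cft f k 0
          = (∑ i, (((cx (M n)) ^ k) i i - cft f k 0)) / (Nn n : ℂ) := by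
        rw [← hv3, Finset.sum_sub_distrib, Matrix.trace, sub_div]
        simp [c'']
      rw [e, norm_div, Complex.norm_natCast, ← mul_div_assoc]
      gcongr
      refine ((norm_sum_le _ _).trans (Finset.sum_le_sum fun i _ => ?_)).trans hds
      have := hd i i
      rwa [sub_self] at this
  refine (hA.final F hF hc).congr fun n => ?_
  rw [show (M n).map (fun x => (x : ℂ)) = cx (M n) from rfl, hv1, Multiset.map_map]
  rw [div_eq_inv_mul, one_div]
  rfl

end AbstractPart3


section OpPart
open MeasureTheory Filter Topology

/-- kernel -/
noncomputable def kk (α t : ℝ) : ℝ := if 0 < t then t ^ (1 - α) else 0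

/-- Riemann–Liouville potential on the line -/
noncomputable def JJ (α : ℝ) (g : ℝ → ℝ) (z : ℝ) : ℝ := ∫ y, kk α (z - y) * g y

/-- second derivative of potential -/
noncomputable def DD (α : ℝ) (g : ℝ → ℝ) (x : ℝ) : ℝ := deriv (deriv (JJ α g)) x

lemma JJ_of_left {α : ℝ} (h1 : 1 < α) (u : ℝ → ℝ) (hu : ∀ y < 0, u y = 0) :
    (fun z => ∫ y in (0:ℝ)..z, (z - y) ^ (1 - α) * u y) = JJ α u := by
  ext z
  rcases le_or_gt 0 z with hz | hz
  · rw [intervalIntegral.integral_of_le hz, ← integral_indicator measurableSet_Ioc, JJ]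
    apply integral_congr_ae
    have : ∀ᵐ y : ℝ, y ≠ 0 := by simp [ae_iff, measure_singleton]
    filter_upwards [this] with y hy
    by_cases h : y ∈ Set.Ioc 0 z
    · rw [Set.indicator_of_mem h, kk]
      rcases h.2.lt_or_eq with h' | h'
      · rw [if_pos (by linarith)]
      · rw [h']; simp [Real.zero_rpow (show (1 - α) ≠ 0 by linarith)]
    · rw [Set.indicator_of_notMem h]
      rcases lt_or_gt_of_ne hy with h' | h'
      · rw [hu y h', mul_zero]
      · have : ¬ (0 < z - y) := by
          intro hh; exact h ⟨h', by linarith⟩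
        simp [kk, this]
  · rw [JJ, intervalIntegral.integral_of_ge hz.le]
    have e : ∫ y, kk α (z - y) * u y = 0 := by
      rw [← integral_zero ℝ ℝ (μ := volume)]
      congr 1; ext y
      by_cases hy : y < 0
      · simp [hu y hy]
      · simp [kk, show ¬ (y < z) by linarith]
    rw [e, neg_eq_zero]
    rw [← integral_indicator measurableSet_Ioc]
    refine (integral_congr_ae ?_).trans (integral_zero ℝ ℝ)
    have : ∀ᵐ y : ℝ, y ≠ 0 := by simp [ae_iff, measure_singleton]
    filter_upwards [this] with y hy
    by_cases h : y ∈ Set.Ioc z 0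
    · rw [Set.indicator_of_mem h, hu y (lt_of_le_of_ne h.2 hy), mul_zero]
    · rw [Set.indicator_of_notMem h]

lemma JJ_of_right {α : ℝ} (h1 : 1 < α) (u : ℝ → ℝ) (hu : ∀ y, 1 ≤ y → u y = 0) :
    (fun z => ∫ y in z..(1:ℝ), (y - z) ^ (1 - α) * u y) = fun z => JJ α (fun y => u (-y)) (-z) := by
  ext z
  have e0 : JJ α (fun y => u (-y)) (-z) = ∫ y, kk α (y - z) * u y := by
    rw [JJ, ← integral_neg_eq_self (fun y => kk α (y - z) * u y)]
    congr 1; ext y; congr 2; ring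
  rw [e0]
  rcases le_or_gt z 1 with hz | hz
  · rw [intervalIntegral.integral_of_le hz, ← integral_indicator measurableSet_Ioc]
    congr 1; ext y
    by_cases h : y ∈ Set.Ioc z 1
    · rw [Set.indicator_of_mem h, kk, if_pos (by linarith [h.1])]
    · rw [Set.indicator_of_notMem h]
      by_cases hy : 1 ≤ y
      · simp [hu y hy]
      · have : ¬ (0 < y - z) := by
          intro hh; exact h ⟨by linarith, by linarith⟩
        simp only [kk, this, if_false, zero_mul]
  · rw [intervalIntegral.integral_of_ge hz.le]
    have e : ∫ y, kk α (y - z) * u y = 0 := by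
      rw [← integral_zero ℝ ℝ (μ := volume)]
      congr 1; ext y
      by_cases hy : 1 ≤ y
      · simp [hu y hy]
      · simp [kk, show ¬ (z < y) by linarith]
    rw [e, neg_eq_zero, ← integral_indicator measurableSet_Ioc, ← integral_zero ℝ ℝ (μ := volume)]
    congr 1; ext y
    by_cases h : y ∈ Set.Ioc 1 z
    · rw [Set.indicator_of_mem h, hu y h.1.le, mul_zero]
    · rw [Set.indicator_of_notMem h]

lemma kk_scale {α c : ℝ} (hc : 0 < c) (t : ℝ) : kk α (c * t) = c ^ (1 - α) * kk α t := by
  unfold kk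
  by_cases ht : 0 < t
  · rw [if_pos ht, if_pos (by positivity), Real.mul_rpow hc.le ht.le]
  · rw [if_neg ht, if_neg (by nlinarith [not_lt.1 ht]), mul_zero]

lemma JJ_scale {α c : ℝ} (hc : 0 < c) (s : ℝ) (g : ℝ → ℝ) (z : ℝ) :
    JJ α (fun y => g (c * y - s)) z = c ^ (α - 2) * JJ α g (c * z - s) := by
  have e1 : ∀ y, kk α (z - y) * g (c * y - s)
      = c ^ (α - 1) * (fun x => kk α ((c * z - s) - (x - s)) * g (x - s)) (c * y) := by
    intro y
    simp only
    have : c * z - s - (c * y - s) = c * (z - y) := by ring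
    rw [this, kk_scale hc, ← mul_assoc, ← mul_assoc, ← Real.rpow_add hc]
    ring_nf; simp
  rw [JJ]
  simp_rw [e1]
  have e2 := Measure.integral_comp_mul_left (fun x => kk α ((c * z - s) - (x - s)) * g (x - s)) c
  rw [integral_const_mul, e2, JJ,
    integral_sub_right_eq_self (fun x => kk α ((c * z - s) - x) * g x) s, abs_of_pos (by positivity),
    smul_eq_mul, ← mul_assoc]
  congr 1
  rw [← Real.rpow_neg_one, ← Real.rpow_add hc]
  congr 1; ring

lemma deriv2_affine (h : ℝ → ℝ) (k c s : ℝ) (x : ℝ) :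
    deriv (deriv (fun z => k * h (c * z - s))) x = k * c ^ 2 * deriv (deriv h) (c * x - s) := by
  have step : ∀ (k : ℝ) (h : ℝ → ℝ), deriv (fun z => k * h (c * z - s))
      = fun z => (k * c) * deriv h (c * z - s) := by
    intro k h
    ext z
    rw [deriv_const_mul_field]
    have := deriv_comp_mul_left c (fun y => h (y - s)) z
    rw [this, deriv_comp_sub_const, smul_eq_mul]
    ring
  rw [step, step]
  ring

lemma DD_scale {α c : ℝ} (hc : 0 < c) (s : ℝ) (g : ℝ → ℝ) (x : ℝ) :
    DD α (fun y => g (c * y - s)) x = c ^ α * DD α g (c * x - s) := by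
  rw [DD, DD, show JJ α (fun y => g (c * y - s)) = fun z => c ^ (α - 2) * JJ α g (c * z - s) from
    funext (JJ_scale hc s g), deriv2_affine]
  congr 1
  rw [← Real.rpow_natCast, ← Real.rpow_add hc]
  congr 1; norm_num

lemma RLD0x_scale {α : ℝ} (h1 : 1 < α) (u g : ℝ → ℝ) {c s : ℝ} (hc : 0 < c)
    (hu : ∀ y < 0, u y = 0) (hg : ∀ y, u y = g (c * y - s)) (x : ℝ) :
    c ^ (-α) * RLD0x α u x = 1 / Real.Gamma (2 - α) * DD α g (c * x - s) := by
  have e := DD_scale (α := α) hc s g x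
  rw [← funext hg] at e
  rw [RLD0x, JJ_of_left h1 u hu, ← DD, e, Real.rpow_neg hc.le]
  have : c ^ α ≠ 0 := by positivity
  field_simp

lemma RLDx1_scale {α : ℝ} (h1 : 1 < α) (u g : ℝ → ℝ) {c s : ℝ} (hc : 0 < c)
    (hu : ∀ y, 1 ≤ y → u y = 0) (hg : ∀ y, u y = g (c * y - s)) (x : ℝ) :
    c ^ (-α) * RLDx1 α u x = 1 / Real.Gamma (2 - α) * DD α (fun y => g (-y)) (-(c * x - s)) := by
  have e := DD_scale (α := α) hc (-s) (fun y => g (-y)) (-x)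
  have e2 : (fun y => (fun y => g (-y)) (c * y - -s)) = fun y => u (-y) := by
    ext y; simp only; rw [hg]; congr 1; ring
  rw [e2] at e
  have e3 := deriv2_affine (JJ α (fun y => u (-y))) 1 (-1) 0 x
  simp only [one_mul, sub_zero, neg_one_mul] at e3
  rw [RLDx1, JJ_of_right h1 u hu, e3, ← DD, e, Real.rpow_neg hc.le,
    show -(c * x - s) = c * -x - -s by ring]
  have : c ^ α ≠ 0 := by positivity
  field_simp

lemma hasDeriv_far {g : ℝ → ℝ} (hg : Integrable g) {R : ℝ} (hR : ∀ y, R < |y| → g y = 0)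
    {s : ℝ} (hs : s ≤ 0) {z : ℝ} (hz : R < z) :
    HasDerivAt (fun z => ∫ y, (z - y) ^ s * g y) (s * ∫ y, (z - y) ^ (s - 1) * g y) z := by
  set δ := (z - R) / 2 with hδ
  have hδ0 : 0 < δ := by rw [hδ]; linarith
  have hsupp : ∀ y, g y ≠ 0 → y ≤ R := by
    intro y hy
    by_contra hh
    exact hy (hR y (by have := le_abs_self y; linarith))
  have meas : ∀ (s z : ℝ), AEStronglyMeasurable (fun y => (z - y) ^ s * g y) volume := by
    intro s z
    exact (Measurable.aestronglyMeasurable (by fun_prop)).mul hg.aestronglyMeasurable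
  have hbd : ∀ z' ∈ Metric.ball z δ, ∀ (s : ℝ), s ≤ 0 → ∀ y, ‖(z' - y) ^ s * g y‖ ≤ δ ^ s * ‖g y‖ := by
    intro z' hz' s hs y
    by_cases hy : g y = 0
    · simp [hy]
    have := hsupp y hy
    have h2 := abs_lt.1 (Metric.mem_ball.1 hz')
    have h3 : δ ≤ z' - y := by linarith
    rw [norm_mul, Real.norm_of_nonneg (Real.rpow_nonneg (by linarith) _)]
    exact mul_le_mul_of_nonneg_right (Real.rpow_le_rpow_of_nonpos hδ0 h3 hs) (norm_nonneg _)
  have := hasDerivAt_integral_of_dominated_loc_of_deriv_le (μ := volume) (𝕜 := ℝ)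
    (F := fun z y => (z - y) ^ s * g y) (F' := fun z y => s * (z - y) ^ (s - 1) * g y) (x₀ := z)
    (s := Metric.ball z δ) (bound := fun y => |s| * (δ ^ (s - 1) * ‖g y‖))
    (Metric.ball_mem_nhds z hδ0) (Eventually.of_forall fun z' => meas s z') ?_ ?_ ?_ ?_ ?_
  · have h2 := this.2
    simp only [mul_assoc] at h2
    rwa [integral_const_mul] at h2
  · exact Integrable.mono' (hg.norm.const_mul _) (meas s z)
      (Eventually.of_forall fun y => hbd z (Metric.mem_ball_self hδ0) s hs y)
  · simp only [mul_assoc]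
    exact (meas (s-1) z).const_mul s
  · refine Eventually.of_forall fun y z' hz' => ?_
    rw [mul_assoc, norm_mul, Real.norm_eq_abs]
    gcongr
    exact hbd z' hz' _ (by linarith) y
  · exact (hg.norm.const_mul _).const_mul _
  · refine Eventually.of_forall fun y z' hz' => ?_
    by_cases hy : g y = 0
    · simp only [hy, mul_zero]; exact hasDerivAt_const _ _
    have := hsupp y hy
    have h2 := abs_lt.1 (Metric.mem_ball.1 hz')
    have h3 : δ ≤ z' - y := by linarith
    have h4 := (((hasDerivAt_id z').sub_const y).rpow_const (p := s) (Or.inl (by simp; linarith))).mul_const (g y)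
    simpa using h4

lemma DD_far_right {α : ℝ} (h1 : 1 < α) {g : ℝ → ℝ} (hg : Integrable g) {R : ℝ}
    (hR : ∀ y, R < |y| → g y = 0) {x : ℝ} (hx : R < x) :
    DD α g x = (1 - α) * (-α * ∫ y, (x - y) ^ (-α - 1) * g y) := by
  have a1 : ∀ z, R < z → JJ α g z = ∫ y, (z - y) ^ (1 - α) * g y := by
    intro z hz
    rw [JJ]
    congr 1; ext y
    by_cases hy : R < |y|
    · simp [hR y hy]
    · have := le_abs_self y
      rw [kk, if_pos (by linarith [not_lt.1 hy])]
  have a2 : ∀ z, R < z → deriv (JJ α g) z = (1 - α) * ∫ y, (z - y) ^ (-α) * g y := by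
    intro z hz
    have h := (hasDeriv_far hg hR (s := 1 - α) (by linarith) hz).deriv
    rw [show 1 - α - 1 = -α by ring] at h
    rw [← h]
    apply Filter.EventuallyEq.deriv_eq
    filter_upwards [lt_mem_nhds hz] with w hw using a1 w hw
  rw [DD]
  have h := ((hasDeriv_far hg hR (s := -α) (by linarith) hx).const_mul (1 - α)).deriv
  rw [← h]
  apply Filter.EventuallyEq.deriv_eq
  filter_upwards [lt_mem_nhds hx] with w hw using a2 w hw

lemma DD_far_left {α : ℝ} {g : ℝ → ℝ} {R : ℝ}
    (hR : ∀ y, y < R → g y = 0) {x : ℝ} (hx : x < R) :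
    DD α g x = 0 := by
  have a1 : ∀ z, z < R → JJ α g z = 0 := by
    intro z hz
    rw [JJ]
    refine (integral_congr_ae (Eventually.of_forall fun y => ?_)).trans (integral_zero ℝ ℝ)
    by_cases hy : y < R
    · simp [hR y hy]
    · simp only [kk]
      rw [if_neg (by linarith), zero_mul]
  have a2 : ∀ z, z < R → deriv (JJ α g) z = 0 := by
    intro z hz
    have : JJ α g =ᶠ[𝓝 z] fun _ => 0 := by
      filter_upwards [gt_mem_nhds hz] with w hw using a1 w hw
    rw [this.deriv_eq]; simp
  rw [DD]
  have : deriv (JJ α g) =ᶠ[𝓝 x] fun _ => 0 := by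
    filter_upwards [gt_mem_nhds hx] with w hw using a2 w hw
  rw [this.deriv_eq]; simp

lemma DD_far {α : ℝ} (h1 : 1 < α) {g : ℝ → ℝ} (hg : Integrable g) {R : ℝ} (hR0 : 0 ≤ R)
    (hR : ∀ y, R < |y| → g y = 0) :
    ∃ C : ℝ, 0 ≤ C ∧ ∀ x, 2 * R + 2 ≤ |x| → |DD α g x| ≤ C * |x| ^ (-1 - α) := by
  have hint0 : 0 ≤ ∫ y, ‖g y‖ := integral_nonneg fun _ => norm_nonneg _
  refine ⟨(α - 1) * (α * ((1/2) ^ (-1 - α) * ∫ y, ‖g y‖)), by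
    have : 0 ≤ (1/2:ℝ) ^ (-1 - α) := by positivity
    have h3 : 0 ≤ α - 1 := by linarith
    have h4 : 0 ≤ α := by linarith
    positivity, fun x hx => ?_⟩
  rcases le_or_gt 0 x with h0 | h0
  · rw [abs_of_nonneg h0] at hx ⊢
    rw [DD_far_right h1 hg hR (by linarith), abs_mul, abs_mul, abs_sub_comm,
      abs_of_pos (show 0 < α - 1 by linarith), abs_neg, abs_of_pos (show 0 < α by linarith)]
    have key : |∫ y, (x - y) ^ (-α - 1) * g y| ≤ ∫ y, ((1/2) ^ (-1 - α) * x ^ (-1 - α)) * ‖g y‖ := by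
      rw [← Real.norm_eq_abs]
      apply norm_integral_le_of_norm_le (hg.norm.const_mul _)
      refine Eventually.of_forall fun y => ?_
      by_cases hy : R < |y|
      · simp [hR y hy]
      have := le_abs_self y
      have h3 : 1/2 * x ≤ x - y := by linarith [not_lt.1 hy]
      rw [norm_mul, Real.norm_of_nonneg (Real.rpow_nonneg (by linarith) _),
        ← Real.mul_rpow (by norm_num) h0, show -α - 1 = -1 - α by ring]
      exact mul_le_mul_of_nonneg_right (Real.rpow_le_rpow_of_nonpos (by linarith) h3 (by linarith))
        (norm_nonneg _)
    rw [integral_const_mul] at key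
    have h3 : 0 ≤ α - 1 := by linarith
    have h4 : 0 ≤ α := by linarith
    calc _ ≤ (α - 1) * (α * ((1/2) ^ (-1 - α) * x ^ (-1 - α) * ∫ y, ‖g y‖)) := by gcongr
      _ = _ := by ring
  · rw [abs_of_neg h0] at hx
    rw [DD_far_left (R := -R) (fun y hy => hR y (by have := neg_le_abs y; linarith)) (by linarith),
      abs_zero]
    have h3 : 0 ≤ α - 1 := by linarith
    have h4 : 0 ≤ α := by linarith
    have h5 : 0 ≤ |x| ^ (-1 - α) := by positivity
    have : 0 ≤ (1/2:ℝ) ^ (-1 - α) := by positivity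
    positivity

end OpPart


section ShapePart
open MeasureTheory Filter Topology

/-- generic B-spline -/
noncomputable def bs (κ : ℕ → ℝ) : ℕ → ℕ → ℝ → ℝ
  | 0, i, x => if κ i ≤ x ∧ x < κ (i + 1) then 1 else 0
  | (k + 1), i, x =>
      (if κ (i + k + 1) = κ i then 0
        else (x - κ i) / (κ (i + k + 1) - κ i) * bs κ k i x)
      + (if κ (i + k + 2) = κ (i + 1) then 0
        else (κ (i + k + 2) - x) / (κ (i + k + 2) - κ (i + 1)) * bs κ k (i + 1) x)

lemma bspline_eq_bs (p n k i : ℕ) (x : ℝ) : bspline p n k i x = bs (knot p n) k i x := by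
  induction k generalizing i with
  | zero => simp only [bspline, bs]
  | succ k ih => simp only [bspline, bs, ih]

lemma bs_affine (κ : ℕ → ℝ) {c : ℝ} (hc : 0 < c) (s : ℝ) (k i : ℕ) (x : ℝ) :
    bs κ k i x = bs (fun r => c * κ r - s) k i (c * x - s) := by
  have h1 : ∀ a b : ℝ, c * a - s ≤ c * b - s ↔ a ≤ b := by
    intro a b; rw [sub_le_sub_iff_right, mul_le_mul_iff_right₀ hc]
  have h2 : ∀ a b : ℝ, c * a - s < c * b - s ↔ a < b := by
    intro a b; rw [sub_lt_sub_iff_right, mul_lt_mul_iff_right₀ hc]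
  have h3 : ∀ a b : ℝ, c * a - s = c * b - s ↔ a = b := by
    intro a b; rw [sub_left_inj, mul_right_inj' hc.ne']
  have h4 : ∀ a b d e : ℝ, (c * a - s - (c * b - s)) / (c * d - s - (c * e - s)) = (a - b) / (d - e) := by
    intro a b d e
    rw [show c * a - s - (c * b - s) = c * (a - b) by ring,
      show c * d - s - (c * e - s) = c * (d - e) by ring, mul_div_mul_left _ _ hc.ne']
  induction k generalizing i with
  | zero => simp only [bs, h1, h2]
  | succ k ih => simp only [bs, h3, h4, ← ih]

lemma bs_local (κ κ' : ℕ → ℝ) (k i i' : ℕ) (h : ∀ r, r ≤ k + 1 → κ (i + r) = κ' (i' + r)) (x : ℝ) :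
    bs κ k i x = bs κ' k i' x := by
  induction k generalizing i i' with
  | zero =>
    have h0 := h 0 (by omega)
    have h1 := h 1 (by omega)
    simp only [add_zero] at h0
    simp only [bs, h0, h1]
  | succ k ih =>
    have h0 := h 0 (by omega)
    have h1 := h 1 (by omega)
    have h2 := h (k + 1) (by omega)
    have h3 := h (k + 2) (by omega)
    simp only [add_zero, ← add_assoc] at h0 h2 h3
    have e1 := ih i i' (fun r hr => h r (by omega))
    have e2 := ih (i + 1) (i' + 1) (fun r hr => by
      have := h (r + 1) (by omega)
      rwa [show i + 1 + r = i + (r + 1) by ring, show i' + 1 + r = i' + (r + 1) by ring])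
    simp only [bs, h0, h1, h2, h3, e1, e2]

lemma bs_supp (κ : ℕ → ℝ) (hκ : Monotone κ) (k i : ℕ) (x : ℝ) (hx : x < κ i ∨ κ (i + k + 1) ≤ x) :
    bs κ k i x = 0 := by
  induction k generalizing i with
  | zero =>
    simp only [bs]
    rw [if_neg]
    rintro ⟨h1, h2⟩
    rcases hx with h | h
    · linarith
    · simp only [add_zero] at h; linarith
  | succ k ih =>
    have e1 : bs κ k i x = 0 := ih i (by
      rcases hx with h | h
      · exact Or.inl h
      · exact Or.inr ((hκ (by omega)).trans h))
    have e2 : bs κ k (i + 1) x = 0 := ih (i + 1) (by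
      rcases hx with h | h
      · exact Or.inl (lt_of_lt_of_le h (hκ (by omega)))
      · exact Or.inr ((hκ (by omega)).trans h))
    simp only [bs, e1, e2, mul_zero, ite_self, add_zero]

lemma bs_int (κ : ℕ → ℝ) (k i : ℕ) (φ : ℝ → ℝ) (hφ : Continuous φ) :
    Integrable (fun x => φ x * bs κ k i x) := by
  induction k generalizing i φ with
  | zero =>
    have : (fun x => φ x * bs κ 0 i x) = Set.indicator (Set.Ico (κ i) (κ (i + 1))) φ := by
      ext x
      simp only [bs, Set.indicator, Set.mem_Ico]
      split_ifs <;> simp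
    rw [this, integrable_indicator_iff measurableSet_Ico]
    exact (hφ.integrableOn_Icc).mono_set Set.Ico_subset_Icc_self
  | succ k ih =>
    have h1 := ih i (fun x => if κ (i + k + 1) = κ i then 0 else
      φ x * ((x - κ i) / (κ (i + k + 1) - κ i))) (by split_ifs <;> fun_prop)
    have h2 := ih (i + 1) (fun x => if κ (i + k + 2) = κ (i + 1) then 0 else
      φ x * ((κ (i + k + 2) - x) / (κ (i + k + 2) - κ (i + 1)))) (by split_ifs <;> fun_prop)
    refine (h1.add h2).congr (Eventually.of_forall fun x => ?_)
    simp only [bs, Pi.add_apply]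
    split_ifs <;> ring

/-- clamped shape -/
def Wn (a b r : ℕ) : ℝ := ((max a (min b r) : ℕ) : ℝ)

lemma Wn_mono (a b : ℕ) : Monotone (Wn a b) := by
  intro r s h
  unfold Wn
  exact_mod_cast max_le_max le_rfl (min_le_min le_rfl h)

lemma knot_mono (p n : ℕ) (hn : 1 ≤ n) : Monotone (knot p n) := by
  have hn' : (0:ℝ) < n := by exact_mod_cast hn
  intro i j hij
  unfold knot
  split_ifs with h1 h2 h3 h4 h5 h6 h7 h8
  all_goals try omega
  all_goals try norm_num
  · have : (p:ℝ) + 1 ≤ j := by exact_mod_cast (by omega : p + 1 ≤ j)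
    exact div_nonneg (by linarith) hn'.le
  · rw [div_le_one hn']
    have : (i:ℝ) ≤ n + p + 1 := by exact_mod_cast (by omega : i ≤ n + p + 1)
    linarith
  · gcongr

lemma knot_nonneg (p n i : ℕ) (hn : 1 ≤ n) : 0 ≤ knot p n i := by
  have := knot_mono p n hn (Nat.zero_le i)
  simpa [knot] using this

lemma knot_le_one (p n i : ℕ) (hn : 1 ≤ n) : knot p n i ≤ 1 := by
  have := knot_mono p n hn (Nat.le_add_right i (n + p + 1))
  have e : knot p n (i + (n + p + 1)) = 1 := by
    unfold knot; rw [if_neg (by omega), if_pos (by omega)]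
  linarith

lemma knot_W (p n i r : ℕ) (hn : 1 ≤ n) (hi : i ≤ n + p + 1) (hr : r ≤ p + 1) :
    (n:ℝ) * knot p n (i + r) - ((i:ℝ) - p - 1) = Wn (p + 1 - i) (min (n + p + 1 - i) (p + 1)) r := by
  have hn' : (n:ℝ) ≠ 0 := by exact_mod_cast (by omega : n ≠ 0)
  unfold knot Wn
  split_ifs with h1 h2
  · rw [show max (p + 1 - i) (min (min (n + p + 1 - i) (p + 1)) r) = p + 1 - i by omega,
      Nat.cast_sub (by omega)]
    push_cast; ring
  · rw [show max (p + 1 - i) (min (min (n + p + 1 - i) (p + 1)) r) = n + p + 1 - i by omega,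
      Nat.cast_sub (by omega)]
    push_cast; ring
  · rw [show max (p + 1 - i) (min (min (n + p + 1 - i) (p + 1)) r) = r by omega]
    field_simp
    push_cast; ring

/-- shape spline -/
noncomputable def gsh (p a b : ℕ) (y : ℝ) : ℝ := bs (Wn a b) p 0 y
/-- shape greville -/
noncomputable def Gsh (p a b : ℕ) : ℝ := (∑ r ∈ Finset.range p, Wn a b (r + 1)) / p

lemma bspline_shape (p n j : ℕ) (hn : 1 ≤ n) (hj : j ≤ n + p + 1) (x : ℝ) :
    bspline p n p j x = gsh p (p + 1 - j) (min (n + p + 1 - j) (p + 1)) ((n:ℝ) * x - ((j:ℝ) - p - 1)) := by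
  have hn' : (0:ℝ) < n := by exact_mod_cast hn
  rw [bspline_eq_bs, bs_affine _ hn' ((j:ℝ) - p - 1), gsh]
  apply bs_local
  intro r hr
  rw [knot_W p n j r hn hj hr, zero_add]

lemma greville_shape (p n i : ℕ) (hp : 1 ≤ p) (hn : 1 ≤ n) (hi : i ≤ n + p + 1) (s : ℝ) :
    (n:ℝ) * greville p n i - (s - p - 1)
      = ((i:ℝ) - s) + Gsh p (p + 1 - i) (min (n + p + 1 - i) (p + 1)) := by
  have hp' : (p:ℝ) ≠ 0 := by exact_mod_cast (by omega : p ≠ 0)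
  have : ∑ r ∈ Finset.range p, Wn (p + 1 - i) (min (n + p + 1 - i) (p + 1)) (r + 1)
      = (n:ℝ) * ∑ r ∈ Finset.range p, knot p n (i + 1 + r) - p * ((i:ℝ) - p - 1) := by
    rw [Finset.mul_sum]
    have e : (p:ℝ) * ((i:ℝ) - p - 1) = ∑ r ∈ Finset.range p, ((i:ℝ) - p - 1) := by
      rw [Finset.sum_const, Finset.card_range, nsmul_eq_mul]
    rw [e, ← Finset.sum_sub_distrib]
    apply Finset.sum_congr rfl
    intro r hr
    rw [← knot_W p n i (r + 1) hn hi (by have := Finset.mem_range.1 hr; omega),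
      show i + (r + 1) = i + 1 + r by ring]
  rw [Gsh, this, greville]
  field_simp
  ring

lemma gsh_supp (p a b : ℕ) (ha : a ≤ p + 1) (hb : b ≤ p + 1) (y : ℝ) (hy : y < 0 ∨ (p:ℝ) + 1 ≤ y) :
    gsh p a b y = 0 := by
  apply bs_supp _ (Wn_mono a b)
  rcases hy with h | h
  · left
    exact lt_of_lt_of_le h (Nat.cast_nonneg _)
  · right
    refine le_trans ?_ h
    unfold Wn
    have : max a (min b (0 + p + 1)) ≤ p + 1 := by omega
    exact_mod_cast this

lemma gsh_int (p a b : ℕ) : Integrable (gsh p a b) := by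
  have := bs_int (Wn a b) p 0 (fun _ => 1) continuous_const
  simp only [one_mul] at this
  exact this

/-- entries -/
noncomputable def Lam (p : ℕ) (α : ℝ) (a b a' b' : ℕ) (m : ℤ) : ℝ :=
  1 / (2 * Real.cos (Real.pi * α / 2)) *
    (1 / Real.Gamma (2 - α) * DD α (gsh p a' b') ((m:ℝ) + Gsh p a b)
      + 1 / Real.Gamma (2 - α) * DD α (fun y => gsh p a' b' (-y)) (-((m:ℝ) + Gsh p a b)))

lemma entry_eq {p n : ℕ} {α : ℝ} (hp : 2 ≤ p) (h1 : 1 < α) (hn : 1 ≤ n) (i j : Fin (n + p - 2)) :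
    (((n:ℝ) ^ (-α)) • Amat p n α) i j
      = Lam p α (p + 1 - ((i:ℕ) + 2)) (min (n + p + 1 - ((i:ℕ) + 2)) (p + 1))
          (p + 1 - ((j:ℕ) + 2)) (min (n + p + 1 - ((j:ℕ) + 2)) (p + 1)) ((i:ℕ) - (j:ℕ)) := by
  have hn' : (0:ℝ) < n := by exact_mod_cast hn
  have hi : (i:ℕ) + 2 ≤ n + p + 1 := by have := i.2; omega
  have hj : (j:ℕ) + 2 ≤ n + p + 1 := by have := j.2; omega
  set gj := gsh p (p + 1 - ((j:ℕ) + 2)) (min (n + p + 1 - ((j:ℕ) + 2)) (p + 1)) with hgj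
  have hg : ∀ y, bspline p n p ((j:ℕ) + 2) y = gj ((n:ℝ) * y - ((((j:ℕ) + 2 : ℕ):ℝ) - p - 1)) :=
    fun y => bspline_shape p n _ hn hj y
  have eL := RLD0x_scale h1 (bspline p n p ((j:ℕ) + 2)) gj hn' (fun y hy => by
    rw [bspline_eq_bs]
    exact bs_supp _ (knot_mono p n hn) _ _ _ (Or.inl (lt_of_lt_of_le hy (knot_nonneg p n _ hn))))
    hg (greville p n ((i:ℕ) + 2))
  have eR := RLDx1_scale h1 (bspline p n p ((j:ℕ) + 2)) gj hn' (fun y hy => by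
    rw [bspline_eq_bs]
    exact bs_supp _ (knot_mono p n hn) _ _ _ (Or.inr ((knot_le_one p n _ hn).trans hy)))
    hg (greville p n ((i:ℕ) + 2))
  rw [greville_shape p n _ (by omega) hn hi] at eL eR
  have ec : ((((i:ℕ) + 2 : ℕ):ℝ)) - (((j:ℕ) + 2 : ℕ):ℝ) = (((((i:ℕ):ℤ) - ((j:ℕ):ℤ) : ℤ)) : ℝ) := by
    push_cast; ring
  rw [ec] at eL eR
  rw [Lam, ← hgj, ← eL, ← eR]
  simp only [Amat, ALmat, ARmat, Matrix.smul_apply, Matrix.add_apply, Matrix.of_apply, smul_eq_mul]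
  ring

lemma decay_int {α : ℝ} (h1 : 1 < α) (F : ℝ → ℝ) (C X G : ℝ) (hC : 0 ≤ C)
    (hF : ∀ x, X ≤ |x| → |F x| ≤ C * |x| ^ (-1 - α)) :
    ∃ C', 0 ≤ C' ∧ ∀ m : ℤ, |F (m + G)| ≤ C' * (1 + |(m:ℝ)|) ^ (-1 - α) := by
  set K : ℤ := ⌈|X| + 2 * |G| + 1⌉ with hK
  have hKr : |X| + 2 * |G| + 1 ≤ (K:ℝ) := Int.le_ceil _
  set S : ℝ := ∑ m ∈ Finset.Icc (-K) K, |F (m + G)| * (1 + |(m:ℝ)|) ^ (1 + α) with hS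
  have hS0 : 0 ≤ S := Finset.sum_nonneg fun m _ => by positivity
  refine ⟨S + C * (1/2) ^ (-1 - α), by positivity, fun m => ?_⟩
  have hpos : 0 < 1 + |(m:ℝ)| := by positivity
  have hp0 : 0 < (1 + |(m:ℝ)|) ^ (-1 - α) := by positivity
  by_cases hm : m ∈ Finset.Icc (-K) K
  · have : |F (m + G)| * (1 + |(m:ℝ)|) ^ (1 + α) ≤ S :=
      Finset.single_le_sum (f := fun m : ℤ => |F (m + G)| * (1 + |(m:ℝ)|) ^ (1 + α))
        (fun m _ => by positivity) hm
    have e : (1 + |(m:ℝ)|) ^ (1 + α) * (1 + |(m:ℝ)|) ^ (-1 - α) = 1 := by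
      rw [← Real.rpow_add hpos]; ring_nf; simp
    calc |F (m + G)| = (|F (m + G)| * (1 + |(m:ℝ)|) ^ (1 + α)) * (1 + |(m:ℝ)|) ^ (-1 - α) := by
          rw [mul_assoc, e, mul_one]
      _ ≤ S * (1 + |(m:ℝ)|) ^ (-1 - α) := by gcongr
      _ ≤ _ := by
          have : 0 ≤ C * (1/2) ^ (-1 - α) := by positivity
          gcongr; linarith
  · have hm2 : (K:ℝ) ≤ |(m:ℝ)| := by
      rw [Finset.mem_Icc, not_and_or] at hm
      rcases hm with h | h
      · have : m ≤ -K := by omega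
        have : (m:ℝ) ≤ -K := by exact_mod_cast this
        have := neg_le_abs (m:ℝ); linarith
      · have : K ≤ m := by omega
        have : (K:ℝ) ≤ m := by exact_mod_cast this
        have := le_abs_self (m:ℝ); linarith
    have h3 : |(m:ℝ)| - |G| ≤ |(m:ℝ) + G| := by
      have := abs_sub_abs_le_abs_sub (m:ℝ) (-G)
      simpa using this
    have h4 : 1/2 * (1 + |(m:ℝ)|) ≤ |(m:ℝ) + G| := by
      have := abs_nonneg X
      linarith
    have h5 : X ≤ |(m:ℝ) + G| := by
      have := le_abs_self X; have := abs_nonneg G; linarith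
    calc |F (m + G)| ≤ C * |(m:ℝ) + G| ^ (-1 - α) := hF _ h5
      _ ≤ C * (1/2 * (1 + |(m:ℝ)|)) ^ (-1 - α) := by
          apply mul_le_mul_of_nonneg_left _ hC
          exact Real.rpow_le_rpow_of_nonpos (by positivity) h4 (by linarith)
      _ = C * (1/2) ^ (-1 - α) * (1 + |(m:ℝ)|) ^ (-1 - α) := by
          rw [Real.mul_rpow (by norm_num) hpos.le]; ring
      _ ≤ _ := by gcongr; linarith

lemma Lam_bound1 {p : ℕ} {α : ℝ} (h1 : 1 < α) (a b a' b' : ℕ) (ha : a' ≤ p + 1) (hb : b' ≤ p + 1) :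
    ∃ C, 0 ≤ C ∧ ∀ m : ℤ, |Lam p α a b a' b' m| ≤ C * (1 + |(m:ℝ)|) ^ (-1 - α) := by
  have hs : ∀ y, (p:ℝ) + 1 < |y| → gsh p a' b' y = 0 := by
    intro y hy
    apply gsh_supp p a' b' ha hb
    rcases lt_abs.1 hy with h | h
    · right; exact h.le
    · left; linarith [Nat.cast_nonneg (α := ℝ) p]
  have hp0 : (0:ℝ) ≤ (p:ℝ) + 1 := by positivity
  obtain ⟨C1, hC1, h1'⟩ := DD_far h1 (gsh_int p a' b') hp0 hs
  obtain ⟨C2, hC2, h2'⟩ := DD_far h1 (gsh_int p a' b').comp_neg hp0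
    (fun y hy => hs (-y) (by rwa [abs_neg]))
  obtain ⟨D1, hD1, k1⟩ := decay_int h1 (DD α (gsh p a' b')) C1 _ (Gsh p a b) hC1 h1'
  obtain ⟨D2, hD2, k2⟩ := decay_int h1 (fun x => DD α (fun y => gsh p a' b' (-y)) (-x)) C2
    (2 * ((p:ℝ) + 1) + 2) (Gsh p a b) hC2
    (fun x hx => by have := h2' (-x) (by rwa [abs_neg]); rwa [abs_neg] at this)
  refine ⟨|1 / (2 * Real.cos (Real.pi * α / 2))| * (|1 / Real.Gamma (2 - α)| * D1
    + |1 / Real.Gamma (2 - α)| * D2), by positivity, fun m => ?_⟩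
  rw [Lam, abs_mul, mul_assoc]
  gcongr
  refine (abs_add_le _ _).trans ?_
  rw [abs_mul, abs_mul, add_mul, mul_assoc, mul_assoc]
  gcongr
  · exact k1 m
  · exact k2 m

lemma Lam_bound {p : ℕ} {α : ℝ} (h1 : 1 < α) :
    ∃ C, 0 ≤ C ∧ ∀ a b a' b', a ≤ p + 1 → b ≤ p + 1 → a' ≤ p + 1 → b' ≤ p + 1 → ∀ m : ℤ,
      |Lam p α a b a' b' m| ≤ C * (1 + |(m:ℝ)|) ^ (-1 - α) := by
  have : ∀ q : (Fin (p + 2) × Fin (p + 2)) × (Fin (p + 2) × Fin (p + 2)),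
      ∃ C, 0 ≤ C ∧ ∀ m : ℤ, |Lam p α q.1.1 q.1.2 q.2.1 q.2.2 m| ≤ C * (1 + |(m:ℝ)|) ^ (-1 - α) :=
    fun q => Lam_bound1 h1 _ _ _ _ (by have := q.2.1.2; omega) (by have := q.2.2.2; omega)
  choose C hC0 hC using this
  refine ⟨∑ q, C q, Finset.sum_nonneg fun q _ => hC0 q, fun a b a' b' ha hb ha' hb' m => ?_⟩
  let q : (Fin (p + 2) × Fin (p + 2)) × (Fin (p + 2) × Fin (p + 2)) :=
    ((⟨a, by omega⟩, ⟨b, by omega⟩), (⟨a', by omega⟩, ⟨b', by omega⟩))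
  refine (hC q m).trans ?_
  gcongr
  exact Finset.single_le_sum (fun q _ => hC0 q) (Finset.mem_univ q)

/-- Toeplitz coefficients -/
noncomputable def tco (p : ℕ) (α : ℝ) (m : ℤ) : ℝ := Lam p α 0 (p + 1) 0 (p + 1) m

lemma matdata {p n : ℕ} {α : ℝ} (hp : 2 ≤ p) (h1 : 1 < α) (hn : 1 ≤ n) (C : ℝ)
    (hC : ∀ a b a' b', a ≤ p + 1 → b ≤ p + 1 → a' ≤ p + 1 → b' ≤ p + 1 → ∀ m : ℤ,
      |Lam p α a b a' b' m| ≤ C * (1 + |(m:ℝ)|) ^ (-1 - α)) :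
    MatData (fun m : ℤ => C * (1 + |(m:ℝ)|) ^ (-1 - α)) (tco p α) (p + 1)
      (((n:ℝ) ^ (-α)) • Amat p n α) where
  le i j := by
    rw [entry_eq hp h1 hn]
    exact hC _ _ _ _ (by omega) (by omega) (by omega) (by omega) _
  eq i j hi hj hi' hj' := by
    rw [entry_eq hp h1 hn, tco]
    congr 1 <;> omega

end ShapePart


section CentralPart
open MeasureTheory Filter Topology

/-- cardinal B-spline -/
noncomputable def cb (k : ℕ) (x : ℝ) : ℝ := bs (fun r => (r:ℝ)) k 0 x

lemma bs_shift (k i : ℕ) (x : ℝ) : bs (fun r => (r:ℝ)) k i x = cb k (x - i) := by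
  rw [bs_affine _ one_pos (i:ℝ), one_mul, cb]
  apply bs_local
  intro r _
  push_cast; ring

lemma cb_zero (x : ℝ) : cb 0 x = if 0 ≤ x ∧ x < 1 then 1 else 0 := by
  simp [cb, bs]

lemma cb_succ (k : ℕ) (x : ℝ) :
    cb (k + 1) x = x / (k + 1) * cb k x + (k + 2 - x) / (k + 1) * cb k (x - 1) := by
  have h := bs_shift k 1 x
  have hk : (0:ℝ) < (k:ℝ) + 1 := by positivity
  conv_lhs => rw [cb, bs]
  simp only [zero_add, h]
  push_cast
  rw [if_neg hk.ne', if_neg (by linarith), show (k:ℝ) + 2 - 1 = k + 1 by ring]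
  simp [cb]

/-- truncated power -/
noncomputable def tp (k : ℕ) (x : ℝ) : ℝ := if 0 ≤ x then x ^ k else 0

lemma tp_succ (k : ℕ) (x : ℝ) : tp (k + 1) x = x * tp k x := by
  unfold tp; split_ifs
  · ring
  · simp

/-- coefficients -/
noncomputable def cc (k j : ℕ) : ℝ := (-1) ^ j * ((k + 1).choose j : ℝ)

lemma cb_formula (k : ℕ) (x : ℝ) :
    cb k x = 1 / (k.factorial : ℝ) * ∑ j ∈ Finset.range (k + 2), cc k j * tp k (x - j) := by
  induction k generalizing x with
  | zero =>
    rw [cb_zero]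
    simp only [Finset.sum_range_succ, Finset.range_zero, Finset.sum_empty, cc, tp]
    by_cases h0 : 0 ≤ x <;> by_cases h1 : x < 1
    · simp [h0, h1]
    · simp [h0, h1, not_lt.1 h1]
    · simp [h0, h1]
    · exact absurd (not_lt.1 h1) (by linarith)
  | succ k ih =>
    rw [cb_succ, ih, ih]
    have hk : (0:ℝ) < (k:ℝ) + 1 := by positivity
    have hf : (0:ℝ) < k.factorial := by positivity
    have e1 : ∑ j ∈ Finset.range (k + 2), cc k j * tp k (x - j)
        = tp k x + ∑ j ∈ Finset.range (k + 2), cc k (j + 1) * tp k (x - (j + 1)) := by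
      have h := Finset.sum_range_succ (fun j => cc k j * tp k (x - j)) (k + 2)
      have h' := Finset.sum_range_succ' (fun j => cc k j * tp k (x - j)) (k + 2)
      rw [h] at h'
      have z : cc k (k + 2) = 0 := by simp [cc]
      rw [z, zero_mul, add_zero] at h'
      rw [h', add_comm]
      simp [cc]
    have e2 : ∑ j ∈ Finset.range (k + 1 + 2), cc (k + 1) j * tp (k + 1) (x - j)
        = x * tp k x + ∑ j ∈ Finset.range (k + 2), cc (k + 1) (j + 1) * ((x - (j + 1)) * tp k (x - (j + 1))) := by
      have h' := Finset.sum_range_succ' (fun j => cc (k + 1) j * tp (k + 1) (x - j)) (k + 2)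
      rw [show k + 1 + 2 = k + 2 + 1 by ring, h', add_comm]
      simp [cc, tp_succ]
    rw [e1, e2, Nat.factorial_succ]
    push_cast
    field_simp
    rw [mul_add, add_assoc]
    congr 1
    rw [Finset.mul_sum, Finset.mul_sum, ← Finset.sum_add_distrib]
    apply Finset.sum_congr rfl
    intro j _
    rw [show x - 1 - (j:ℝ) = x - (j + 1) by ring]
    have c1 : ((k + 1 + 1).choose (j + 1) : ℝ) = (k + 1).choose j + (k + 1).choose (j + 1) := by
      rw [Nat.choose_succ_succ]; push_cast; ring
    have c2 : ((k:ℝ) + 1 + 1) * (k + 1).choose j = (k + 1 + 1).choose (j + 1) * (j + 1) := by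
      exact_mod_cast Nat.add_one_mul_choose_eq (k + 1) j
    have c3 : cc k j = (-1) ^ j * ((k + 1).choose j : ℝ) := rfl
    have c4 : cc k (j + 1) = -(-1) ^ j * ((k + 1).choose (j + 1) : ℝ) := by rw [cc, pow_succ]; ring
    have c5 : cc (k + 1) (j + 1) = -(-1) ^ j * ((k + 1 + 1).choose (j + 1) : ℝ) := by
      rw [cc, pow_succ]; ring
    rw [c3, c4, c5]
    have c6 : ((k + 1 + 1).choose (j + 1) : ℝ) * (x - (j + 1))
        = x * (k + 1).choose (j + 1) - ((k:ℝ) + 2 - x) * (k + 1).choose j := by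
      rw [mul_sub, ← c2, c1]; ring
    linear_combination (-1) ^ j * tp k (x - (j + 1)) * c6

lemma cb_symm (k : ℕ) (x : ℝ) (hx : ∀ i : ℤ, x ≠ i) : cb k (k + 1 - x) = cb k x := by
  induction k generalizing x with
  | zero =>
    have h0 := hx 0
    have h1 := hx 1
    push_cast at h0 h1
    rw [cb_zero, cb_zero]
    apply if_congr _ rfl rfl
    constructor
    · rintro ⟨a, b⟩
      push_cast at a b
      exact ⟨by linarith, lt_of_le_of_ne (by linarith) h1⟩
    · rintro ⟨a, b⟩
      have := lt_of_le_of_ne a (Ne.symm h0)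
      push_cast
      exact ⟨by linarith, by linarith⟩
  | succ k ih =>
    rw [cb_succ, cb_succ]
    have a := ih x hx
    have b := ih (x - 1) (fun i hi => hx (i + 1) (by push_cast; linarith))
    rw [show ((k + 1 : ℕ):ℝ) + 1 - x = k + 1 - (x - 1) by push_cast; ring, b,
      show (k:ℝ) + 1 - (x - 1) - 1 = k + 1 - x by ring, a]
    ring

lemma gsh_central (p : ℕ) : gsh p 0 (p + 1) = cb p := by
  ext y
  rw [gsh, cb]
  apply bs_local
  intro r hr
  simp only [Wn, zero_add]
  congr 1; omega

lemma Gsh_central (p : ℕ) (hp : 2 ≤ p) : Gsh p 0 (p + 1) = ((p:ℝ) + 1) / 2 := by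
  have : ∀ q, q ≤ p → ∑ r ∈ Finset.range q, Wn 0 (p + 1) (r + 1) = q * ((q:ℝ) + 1) / 2 := by
    intro q
    induction q with
    | zero => simp
    | succ q ih =>
      intro hq
      rw [Finset.sum_range_succ, ih (by omega), Wn, show max 0 (min (p + 1) (q + 1)) = q + 1 by omega]
      push_cast; ring
  rw [Gsh, this p le_rfl]
  have hp' : (p:ℝ) ≠ 0 := by exact_mod_cast (by omega : p ≠ 0)
  field_simp

lemma JJ_congr_ae {α : ℝ} {g g' : ℝ → ℝ} (h : g =ᵐ[volume] g') : JJ α g = JJ α g' := by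
  ext z
  apply integral_congr_ae
  filter_upwards [h] with y hy
  rw [hy]

lemma DD_cb_neg (p : ℕ) (α w : ℝ) :
    DD α (fun y => cb p (-y)) w = DD α (cb p) (w + (p + 1)) := by
  have h : (fun y => cb p (-y)) =ᵐ[volume] fun y => cb p (1 * y - (-((p:ℝ) + 1))) := by
    have hc : (Set.range (fun i : ℤ => (i:ℝ))).Countable := Set.countable_range _
    have : ∀ᵐ y : ℝ, y ∉ Set.range (fun i : ℤ => (i:ℝ)) := by
      exact hc.ae_notMem volume
    filter_upwards [this] with y hy
    rw [← cb_symm p (-y) (fun i hi => hy ⟨-i, by push_cast; linarith⟩)]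
    congr 1; ring
  rw [DD, JJ_congr_ae h, ← DD, DD_scale one_pos, Real.one_rpow, one_mul]
  congr 1; ring

/-- positive-part power -/
noncomputable def pw (s x : ℝ) : ℝ := (max x 0) ^ s

lemma pw_cont {s : ℝ} (hs : 0 ≤ s) : Continuous (pw s) := by
  unfold pw
  exact (continuous_id.max continuous_const).rpow_const (fun _ => Or.inr hs)

lemma pw_deriv {s : ℝ} (hs : 1 < s) (x : ℝ) : HasDerivAt (pw s) (s * pw (s - 1) x) x := by
  rcases lt_trichotomy x 0 with h | h | h
  · have e : pw s =ᶠ[𝓝 x] fun _ => 0 := by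
      filter_upwards [gt_mem_nhds h] with y hy
      rw [pw, max_eq_right (le_of_lt hy), Real.zero_rpow (by linarith)]
    have e2 : s * pw (s - 1) x = 0 := by
      rw [pw, max_eq_right h.le, Real.zero_rpow (by linarith), mul_zero]
    rw [e2]
    exact (hasDerivAt_const x (0:ℝ)).congr_of_eventuallyEq e
  · subst h
    have e2 : s * pw (s - 1) 0 = 0 := by
      rw [pw, max_self, Real.zero_rpow (by linarith), mul_zero]
    rw [e2]
    rw [hasDerivAt_iff_isLittleO_nhds_zero]
    have e3 : pw s 0 = 0 := by rw [pw, max_self, Real.zero_rpow (by linarith)]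
    simp only [zero_add, e3, sub_zero, smul_zero]
    rw [Asymptotics.isLittleO_iff]
    intro c hc
    have hcont := (pw_cont (s := s - 1) (by linarith)).tendsto 0
    have e4 : pw (s - 1) 0 = 0 := by rw [pw, max_self, Real.zero_rpow (by linarith)]
    rw [e4] at hcont
    filter_upwards [hcont.eventually (gt_mem_nhds hc)] with y hy
    rcases le_or_gt y 0 with h | h
    · rw [pw, max_eq_right h, Real.zero_rpow (by linarith), norm_zero]; positivity
    · rw [pw, max_eq_left h.le] at hy ⊢
      rw [Real.norm_of_nonneg (by positivity), Real.norm_of_nonneg h.le]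
      calc y ^ s = y ^ (s - 1) * y := by
            rw [← Real.rpow_add_one h.ne']; congr 1; ring
        _ ≤ c * y := by gcongr
  · have e : pw s =ᶠ[𝓝 x] fun y => y ^ s := by
      filter_upwards [lt_mem_nhds h] with y hy
      rw [pw, max_eq_left (le_of_lt hy)]
    rw [pw, max_eq_left h.le]
    exact (Real.hasDerivAt_rpow_const (Or.inl h.ne')).congr_of_eventuallyEq e

lemma beta_real {s t z : ℝ} (hs : 0 < s) (ht : 0 < t) (hz : 0 < z) :
    ∫ y in (0:ℝ)..z, y ^ (s - 1) * (z - y) ^ (t - 1)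
      = z ^ (s + t - 1) * (Real.Gamma s * Real.Gamma t / Real.Gamma (s + t)) := by
  have h := Complex.betaIntegral_scaled (s:ℂ) (t:ℂ) hz
  rw [Complex.betaIntegral_eq_Gamma_mul_div _ _ (by simpa) (by simpa)] at h
  apply Complex.ofReal_injective
  rw [← intervalIntegral.integral_ofReal]
  push_cast [Complex.ofReal_cpow hz.le, ← Complex.Gamma_ofReal]
  rw [← h]
  apply intervalIntegral.integral_congr
  intro y hy
  rw [Set.uIcc_of_le hz.le] at hy
  simp only
  rw [Complex.ofReal_cpow hy.1, Complex.ofReal_cpow (by linarith [hy.2])]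
  push_cast; rfl

lemma kk_tp (α : ℝ) (h1 : 1 < α) (p : ℕ) (hp : 1 ≤ p) (z c : ℝ) :
    (fun y => kk α (z - y) * tp p (y - c))
      = Set.indicator (Set.Ioc c z) (fun y => (z - y) ^ (1 - α) * (y - c) ^ p) := by
  ext y
  by_cases h : y ∈ Set.Ioc c z
  · rw [Set.indicator_of_mem h, tp, if_pos (by linarith [h.1])]
    rcases h.2.lt_or_eq with h' | h'
    · rw [kk, if_pos (by linarith)]
    · rw [h']; simp [kk, Real.zero_rpow (show (1 - α) ≠ 0 by linarith)]
  · rw [Set.indicator_of_notMem h]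
    by_cases h' : c < y
    · have : ¬ (0 < z - y) := fun hh => h ⟨h', by linarith⟩
      rw [kk, if_neg this, zero_mul]
    · rcases (not_lt.1 h').lt_or_eq with h'' | h''
      · rw [tp, if_neg (by linarith), mul_zero]
      · rw [h'', sub_self, tp, if_pos le_rfl, zero_pow (by omega), mul_zero]

lemma kk_tp_int {α : ℝ} (h1 : 1 < α) (h2 : α < 2) {p : ℕ} (hp : 1 ≤ p) (z c : ℝ) :
    Integrable (fun y => kk α (z - y) * tp p (y - c)) := by
  rw [kk_tp α h1 p hp, integrable_indicator_iff measurableSet_Ioc]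
  rcases le_or_gt c z with h | h
  · rw [← intervalIntegrable_iff_integrableOn_Ioc_of_le h]
    apply IntervalIntegrable.mul_continuousOn _ (by fun_prop)
    have := (intervalIntegral.intervalIntegrable_rpow' (a := z - c) (b := 0) (r := 1 - α) (by linarith)).comp_sub_left z
    simpa using this
  · rw [Set.Ioc_eq_empty (by linarith)]; exact integrableOn_empty

lemma kk_tp_val {α : ℝ} (h1 : 1 < α) (h2 : α < 2) {p : ℕ} (hp : 1 ≤ p) (z c : ℝ) :
    ∫ y, kk α (z - y) * tp p (y - c)
      = (p.factorial * Real.Gamma (2 - α) / Real.Gamma (p + 3 - α)) * pw (p + 2 - α) (z - c) := by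
  have hp' : (1:ℝ) ≤ p := by exact_mod_cast hp
  rw [kk_tp α h1 p hp, integral_indicator measurableSet_Ioc]
  rcases lt_or_ge c z with h | h
  · rw [← intervalIntegral.integral_of_le h.le]
    have e := intervalIntegral.integral_comp_sub_right (a := c) (b := z)
      (fun y => (z - c - y) ^ (1 - α) * y ^ p) c
    simp only [sub_self] at e
    have e2 := beta_real (s := p + 1) (t := 2 - α) (z := z - c) (by positivity) (by linarith) (by linarith)
    calc _ = ∫ y in c..z, (z - c - (y - c)) ^ (1 - α) * (y - c) ^ p := by
          congr 1; ext y; congr 2; ring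
      _ = _ := by
          rw [e, pw, max_eq_left (by linarith), Real.Gamma_nat_eq_factorial] at *
          rw [show (p:ℝ) + 2 - α = p + 1 + (2 - α) - 1 by ring,
            show (p:ℝ) + 3 - α = p + 1 + (2 - α) by ring, mul_comm, ← e2]
          congr 1; ext y
          rw [mul_comm]; congr 1
          · rw [← Real.rpow_natCast]; congr 1; ring
          · congr 1; ring
  · rw [Set.Ioc_eq_empty (by linarith), pw, max_eq_right (by linarith),
      Real.zero_rpow (by linarith)]
    simp

/-- the fractional derivative of the cardinal B-spline -/
noncomputable def ell (p : ℕ) (α x : ℝ) : ℝ :=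
  1 / Real.Gamma (p + 1 - α) * ∑ j ∈ Finset.range (p + 2), cc p j * pw (p - α) (x - j)

lemma JJ_cb {α : ℝ} (h1 : 1 < α) (h2 : α < 2) {p : ℕ} (hp : 1 ≤ p) (z : ℝ) :
    JJ α (cb p) z = (Real.Gamma (2 - α) / Real.Gamma (p + 3 - α)) *
      ∑ j ∈ Finset.range (p + 2), cc p j * pw (p + 2 - α) (z - j) := by
  have e : ∀ y, kk α (z - y) * cb p y = ∑ j ∈ Finset.range (p + 2),
      (1 / (p.factorial:ℝ) * cc p j) * (kk α (z - y) * tp p (y - j)) := by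
    intro y
    rw [cb_formula, Finset.mul_sum, Finset.mul_sum]
    apply Finset.sum_congr rfl; intro j _; ring
  rw [JJ]
  simp_rw [e]
  rw [integral_finset_sum _ (fun (j : ℕ) _ => (kk_tp_int h1 h2 hp z (j:ℝ)).const_mul (1 / (p.factorial:ℝ) * cc p j)), Finset.mul_sum]
  apply Finset.sum_congr rfl; intro j _
  rw [integral_const_mul, kk_tp_val h1 h2 hp]
  have : (p.factorial : ℝ) ≠ 0 := by positivity
  field_simp

lemma DD_cb {α : ℝ} (h1 : 1 < α) (h2 : α < 2) {p : ℕ} (hp : 2 ≤ p) (x : ℝ) :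
    1 / Real.Gamma (2 - α) * DD α (cb p) x = ell p α x := by
  have hp' : (2:ℝ) ≤ p := by exact_mod_cast hp
  have d : ∀ (K s : ℝ), 1 < s → deriv (fun z => K * ∑ j ∈ Finset.range (p + 2), cc p j * pw s (z - j))
      = fun z => (K * s) * ∑ j ∈ Finset.range (p + 2), cc p j * pw (s - 1) (z - j) := by
    intro K s hs
    ext z
    have : HasDerivAt (fun z => K * ∑ j ∈ Finset.range (p + 2), cc p j * pw s (z - j))
        (K * ∑ j ∈ Finset.range (p + 2), cc p j * (s * pw (s - 1) (z - j))) z := by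
      apply HasDerivAt.const_mul
      apply HasDerivAt.fun_sum
      intro j _
      apply HasDerivAt.const_mul
      exact (pw_deriv hs (z - j)).comp_sub_const z j
    rw [this.deriv, mul_assoc, Finset.mul_sum, Finset.mul_sum, Finset.mul_sum]
    apply Finset.sum_congr rfl; intro j _; ring
  rw [DD, funext (JJ_cb h1 h2 (show 1 ≤ p by omega)), d _ _ (by linarith), d _ _ (by linarith), ell]
  simp only
  have g1 : Real.Gamma (p + 3 - α) = (p + 2 - α) * ((p + 1 - α) * Real.Gamma (p + 1 - α)) := by
    rw [show (p:ℝ) + 3 - α = (p + 2 - α) + 1 by ring, Real.Gamma_add_one (by linarith),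
      show (p:ℝ) + 2 - α = (p + 1 - α) + 1 by ring, Real.Gamma_add_one (by linarith)]
  have g2 : Real.Gamma (2 - α) ≠ 0 := (Real.Gamma_pos_of_pos (by linarith)).ne'
  have g3 : Real.Gamma (p + 1 - α) ≠ 0 := (Real.Gamma_pos_of_pos (by linarith)).ne'
  have g4 : (p:ℝ) + 2 - α ≠ 0 := by linarith
  have g5 : (p:ℝ) + 1 - α ≠ 0 := by linarith
  rw [g1, show (p:ℝ) + 2 - α - 1 - 1 = p - α by ring, show (p:ℝ) + 2 - α - 1 = p + 1 - α by ring]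
  field_simp

/-- the generating function for the Toeplitz coefficients -/
noncomputable def TT (p : ℕ) (α x : ℝ) : ℝ :=
  1 / (2 * Real.cos (Real.pi * α / 2)) * (ell p α (x + (p + 1) / 2) + ell p α (-x + (p + 1) / 2))

lemma tco_eq {α : ℝ} (h1 : 1 < α) (h2 : α < 2) {p : ℕ} (hp : 2 ≤ p) (m : ℤ) :
    tco p α m = TT p α m := by
  rw [tco, Lam, gsh_central, Gsh_central p hp, DD_cb_neg, DD_cb h1 h2 hp, DD_cb h1 h2 hp, TT]
  congr 3; ring

lemma TT_even (p : ℕ) (α x : ℝ) : TT p α (-x) = TT p α x := by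
  rw [TT, TT, neg_neg]; ring

lemma ell_cont {α : ℝ} (h2 : α < 2) {p : ℕ} (hp : 2 ≤ p) : Continuous (ell p α) := by
  have hp' : (2:ℝ) ≤ p := by exact_mod_cast hp
  unfold ell
  refine continuous_const.mul (continuous_finset_sum _ fun j _ => continuous_const.mul ?_)
  exact (pw_cont (by linarith)).comp (continuous_id.sub continuous_const)

lemma ell_decay {α : ℝ} (h1 : 1 < α) (h2 : α < 2) {p : ℕ} (hp : 2 ≤ p) :
    ∃ C X : ℝ, 0 ≤ C ∧ ∀ x, X ≤ |x| → |ell p α x| ≤ C * |x| ^ (-1 - α) := by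
  have hs : ∀ y, (p:ℝ) + 1 < |y| → cb p y = 0 := by
    intro y hy
    rw [← gsh_central]
    apply gsh_supp p 0 (p + 1) (by omega) le_rfl
    rcases lt_abs.1 hy with h | h
    · right; exact h.le
    · left; linarith [Nat.cast_nonneg (α := ℝ) p]
  obtain ⟨C, hC, h⟩ := DD_far h1 (by rw [← gsh_central]; exact gsh_int _ _ _ : Integrable (cb p))
    (by positivity) hs
  refine ⟨|1 / Real.Gamma (2 - α)| * C, 2 * ((p:ℝ) + 1) + 2, by positivity, fun x hx => ?_⟩
  rw [← DD_cb h1 h2 hp, abs_mul, mul_assoc]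
  gcongr
  exact h x hx

end CentralPart


section LaplacePart
open MeasureTheory Filter Topology

lemma lap_intg {s δ : ℝ} (hs : 0 < s) (hδ : 0 < δ) :
    IntegrableOn (fun x : ℝ => x ^ (s - 1) * Real.exp (-(δ * x))) (Set.Ioi 0) := by
  have := integrableOn_rpow_mul_exp_neg_mul_rpow (s := s - 1) (p := 1) (b := δ) (by linarith) one_pos hδ
  simpa [neg_mul] using this

/-- Laplace transform of a power -/
noncomputable def LF (s : ℝ) (z : ℂ) : ℂ :=
  ∫ x in Set.Ioi (0:ℝ), ((x ^ (s - 1) : ℝ) : ℂ) * Complex.exp (-(z * x))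

lemma lap_norm {z : ℂ} (x s : ℝ) (hx : 0 < x) :
    ‖((x ^ (s - 1) : ℝ) : ℂ) * Complex.exp (-(z * x))‖ = x ^ (s - 1) * Real.exp (-(z.re * x)) := by
  rw [norm_mul, Complex.norm_real, Real.norm_of_nonneg (by positivity), Complex.norm_exp]
  simp

lemma lap_meas (s : ℝ) (z : ℂ) (μ : Measure ℝ) : AEStronglyMeasurable
    (fun x : ℝ => ((x ^ (s - 1) : ℝ) : ℂ) * Complex.exp (-(z * x))) μ := by
  apply Measurable.aestronglyMeasurable
  fun_prop

lemma lap_int {s : ℝ} (hs : 0 < s) {z : ℂ} (hz : 0 < z.re) :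
    IntegrableOn (fun x : ℝ => ((x ^ (s - 1) : ℝ) : ℂ) * Complex.exp (-(z * x))) (Set.Ioi 0) := by
  refine Integrable.mono' (lap_intg hs hz) (lap_meas s z _) ?_
  filter_upwards [ae_restrict_mem measurableSet_Ioi] with x hx
  rw [lap_norm x s hx]

lemma LF_diff {s : ℝ} (hs : 0 < s) {z : ℂ} (hz : 0 < z.re) : DifferentiableAt ℂ (LF s) z := by
  have h := hasDerivAt_integral_of_dominated_loc_of_deriv_le (μ := volume.restrict (Set.Ioi (0:ℝ))) (𝕜 := ℂ)
    (F := fun (z : ℂ) (x : ℝ) => ((x ^ (s - 1) : ℝ) : ℂ) * Complex.exp (-(z * x)))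
    (F' := fun (z : ℂ) (x : ℝ) => ((x ^ (s - 1) : ℝ) : ℂ) * (Complex.exp (-(z * x)) * (-x))) (x₀ := z)
    (s := Metric.ball z (z.re / 2)) (bound := fun x => x ^ ((s + 1) - 1) * Real.exp (-(z.re / 2 * x)))
    (Metric.ball_mem_nhds z (by linarith)) (Eventually.of_forall fun z' => lap_meas s z' _)
    (lap_int hs hz) ?_ ?_ (lap_intg (by linarith) (by linarith)) ?_
  · exact h.2.differentiableAt
  · apply Measurable.aestronglyMeasurable
    fun_prop
  · filter_upwards [ae_restrict_mem measurableSet_Ioi] with x hx z' hz'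
    have hx : 0 < x := hx
    rw [← mul_assoc, norm_mul, lap_norm x s hx, norm_neg, Complex.norm_real, Real.norm_of_nonneg hx.le,
      mul_right_comm, show s + 1 - 1 = (s - 1) + 1 by ring, Real.rpow_add_one hx.ne']
    have h1 : |(z' - z).re| ≤ ‖z' - z‖ := Complex.abs_re_le_norm _
    have h2 : ‖z' - z‖ < z.re / 2 := by simpa [dist_eq_norm] using Metric.mem_ball.1 hz'
    have h3 := (abs_lt.1 (h1.trans_lt h2)).1
    rw [Complex.sub_re] at h3
    gcongr
    linarith
  · filter_upwards with x z' _
    have h1 : HasDerivAt (fun z : ℂ => -(z * x)) (-x) z' := by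
      simpa using ((hasDerivAt_id z').mul_const (x:ℂ)).fun_neg
    exact (h1.cexp).const_mul _

lemma LF_eq {s : ℝ} (hs : 0 < s) {z : ℂ} (hz : 0 < z.re) :
    LF s z = (Real.Gamma s : ℂ) * z ^ (-s : ℂ) := by
  have hU : IsOpen {z : ℂ | 0 < z.re} := isOpen_lt continuous_const Complex.continuous_re
  have a1 : AnalyticOnNhd ℂ (LF s) {z : ℂ | 0 < z.re} :=
    DifferentiableOn.analyticOnNhd (fun z hz => (LF_diff hs hz).differentiableWithinAt) hU
  have a2 : AnalyticOnNhd ℂ (fun z : ℂ => (Real.Gamma s : ℂ) * z ^ (-s : ℂ)) {z : ℂ | 0 < z.re} := by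
    refine DifferentiableOn.analyticOnNhd (fun z hz => ?_) hU
    apply DifferentiableAt.differentiableWithinAt
    apply DifferentiableAt.const_mul
    exact differentiableAt_id.cpow_const (Or.inl hz)
  have hconv : Convex ℝ {z : ℂ | 0 < z.re} := convex_halfSpace_re_gt 0
  refine a1.eqOn_of_preconnected_of_frequently_eq a2 hconv.isPreconnected (z₀ := 1) (by simp) ?_ hz
  have real_case : ∀ r : ℝ, 0 < r → LF s r = (Real.Gamma s : ℂ) * (r:ℂ) ^ (-s : ℂ) := by
    intro r hr
    have h := Real.integral_rpow_mul_exp_neg_mul_Ioi hs hr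
    have e : (r:ℂ) ^ (-s : ℂ) = (((1 / r) ^ s : ℝ) : ℂ) := by
      rw [← Complex.ofReal_neg, ← Complex.ofReal_cpow hr.le, Real.rpow_neg hr.le, one_div,
        Real.inv_rpow hr.le]
    rw [e, mul_comm, ← Complex.ofReal_mul, ← h, LF, ← integral_complex_ofReal]
    congr 1; ext x; push_cast; rfl
  have ht : Tendsto (fun n : ℕ => ((1 + 1 / ((n:ℝ) + 1) : ℝ) : ℂ)) atTop (𝓝[≠] 1) := by
    apply tendsto_nhdsWithin_iff.2
    refine ⟨?_, Eventually.of_forall fun n => ?_⟩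
    · have h := (tendsto_one_div_add_atTop_nhds_zero_nat (𝕜 := ℝ)).const_add 1
      rw [add_zero] at h
      have := (Complex.continuous_ofReal.tendsto 1).comp h
      rw [Complex.ofReal_one] at this
      exact this
    · have : (0:ℝ) < 1 / ((n:ℝ) + 1) := by positivity
      intro hh
      have h' : ((1 + 1 / ((n:ℝ) + 1) : ℝ) : ℂ) = ((1:ℝ):ℂ) := by rw [hh]; simp
      have := Complex.ofReal_injective h'
      linarith
  apply ht.frequently
  apply Frequently.of_forall
  intro n
  exact real_case _ (by positivity)

lemma pw_lap {s : ℝ} (hs : 1 < s) {z : ℂ} (hz : 0 < z.re) (c : ℝ) :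
    Integrable (fun x : ℝ => ((pw (s - 1) (x - c) : ℝ) : ℂ) * Complex.exp (-(z * x))) ∧
    ∫ x : ℝ, ((pw (s - 1) (x - c) : ℝ) : ℂ) * Complex.exp (-(z * x))
      = Complex.exp (-(z * c)) * ((Real.Gamma s : ℂ) * z ^ (-s : ℂ)) := by
  have e0 : (fun x : ℝ => ((pw (s - 1) x : ℝ) : ℂ) * Complex.exp (-(z * x)))
      = Set.indicator (Set.Ioi 0) (fun x : ℝ => ((x ^ (s - 1) : ℝ) : ℂ) * Complex.exp (-(z * x))) := by
    ext x
    by_cases hx : 0 < x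
    · rw [Set.indicator_of_mem (by exact hx), pw, max_eq_left hx.le]
    · rw [Set.indicator_of_notMem (by exact hx), pw, max_eq_right (not_lt.1 hx),
        Real.zero_rpow (by linarith)]
      simp
  have i0 : Integrable (fun x : ℝ => ((pw (s - 1) x : ℝ) : ℂ) * Complex.exp (-(z * x))) := by
    rw [e0, integrable_indicator_iff measurableSet_Ioi]; exact lap_int (by linarith) hz
  have v0 : ∫ x : ℝ, ((pw (s - 1) x : ℝ) : ℂ) * Complex.exp (-(z * x))
      = (Real.Gamma s : ℂ) * z ^ (-s : ℂ) := by
    rw [e0, integral_indicator measurableSet_Ioi, ← LF_eq (by linarith) hz, LF]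
  have e1 : (fun x : ℝ => ((pw (s - 1) (x - c) : ℝ) : ℂ) * Complex.exp (-(z * x)))
      = fun x : ℝ => Complex.exp (-(z * c)) *
        (fun x : ℝ => ((pw (s - 1) x : ℝ) : ℂ) * Complex.exp (-(z * x))) (x - c) := by
    ext x
    simp only
    rw [mul_left_comm, ← Complex.exp_add]
    congr 2; push_cast; ring
  rw [e1]
  constructor
  · exact (i0.comp_sub_right c).const_mul _
  · rw [integral_const_mul, integral_sub_right_eq_self (fun x : ℝ => ((pw (s - 1) x : ℝ) : ℂ) * Complex.exp (-(z * x))) c, v0]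

lemma ell_lap {α : ℝ} (h2 : α < 2) {p : ℕ} (hp : 2 ≤ p) {z : ℂ} (hz : 0 < z.re) :
    ∫ x : ℝ, ((ell p α x : ℝ) : ℂ) * Complex.exp (-(z * x))
      = z ^ (-((p + 1 - α : ℝ) : ℂ)) * (1 - Complex.exp (-z)) ^ (p + 1) := by
  have hp' : (2:ℝ) ≤ p := by exact_mod_cast hp
  have hs : 1 < (p:ℝ) + 1 - α := by linarith
  have hG : (Real.Gamma (p + 1 - α) : ℂ) ≠ 0 :=
    Complex.ofReal_ne_zero.2 (Real.Gamma_pos_of_pos (by linarith)).ne'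
  have e : ∀ x : ℝ, ((ell p α x : ℝ) : ℂ) * Complex.exp (-(z * x)) =
      ∑ j ∈ Finset.range (p + 2), ((1 / Real.Gamma (p + 1 - α) : ℂ) * (cc p j : ℂ)) *
        (((pw ((p + 1 - α) - 1) (x - (j:ℕ)) : ℝ) : ℂ) * Complex.exp (-(z * x))) := by
    intro x
    rw [ell, show (p:ℝ) + 1 - α - 1 = p - α by ring]
    push_cast
    rw [Finset.mul_sum, Finset.sum_mul]
    apply Finset.sum_congr rfl; intro j _; ring
  simp_rw [e]
  rw [integral_finset_sum _ (fun (j : ℕ) _ => (pw_lap hs hz (j:ℝ)).1.const_mul ((1 / Real.Gamma (p + 1 - α) : ℂ) * (cc p j : ℂ)))]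
  have e2 : (1 - Complex.exp (-z)) ^ (p + 1) = ∑ j ∈ Finset.range (p + 2),
      (cc p j : ℂ) * Complex.exp (-(z * (j:ℕ))) := by
    rw [sub_eq_neg_add, add_pow]
    apply Finset.sum_congr rfl
    intro j _
    rw [cc, show -(z * (j:ℂ)) = (j:ℂ) * (-z) by ring, Complex.exp_nat_mul, neg_pow]
    push_cast; ring
  rw [e2, Finset.mul_sum]
  apply Finset.sum_congr rfl; intro j _
  rw [integral_const_mul, (pw_lap hs hz (j:ℝ)).2]
  push_cast
  field_simp

end LaplacePart


section FourierPart
open MeasureTheory Filter Topology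

lemma ell_bound {α : ℝ} (h1 : 1 < α) (h2 : α < 2) {p : ℕ} (hp : 2 ≤ p) :
    ∃ C : ℝ, 0 ≤ C ∧ ∀ x, |ell p α x| ≤ C * (1 + |x|) ^ (-(1 + α)) := by
  obtain ⟨C, X, hC, h⟩ := ell_decay h1 h2 hp
  set Y := max X 1 with hY
  have hY1 : 1 ≤ Y := le_max_right _ _
  obtain ⟨B, hB⟩ := (isCompact_Icc (a := -Y) (b := Y)).exists_bound_of_continuousOn
    (ell_cont h2 hp).continuousOn
  have hB0 : 0 ≤ B := (norm_nonneg _).trans (hB 0 ⟨by linarith, by linarith⟩)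
  have hYp : 0 < 1 + Y := by linarith
  refine ⟨B * (1 + Y) ^ (1 + α) + C * (1/2) ^ (-(1 + α)), by positivity, fun x => ?_⟩
  have hpos : 0 < 1 + |x| := by positivity
  by_cases hx : |x| ≤ Y
  · have e := hB x (abs_le.1 hx)
    rw [Real.norm_eq_abs] at e
    have e2 : 1 ≤ (1 + Y) ^ (1 + α) * (1 + |x|) ^ (-(1 + α)) := by
      rw [Real.rpow_neg hpos.le, ← div_eq_mul_inv, one_le_div (by positivity)]
      gcongr
    calc |ell p α x| ≤ B * 1 := by rw [mul_one]; exact e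
      _ ≤ B * ((1 + Y) ^ (1 + α) * (1 + |x|) ^ (-(1 + α))) := by gcongr
      _ = (B * (1 + Y) ^ (1 + α)) * (1 + |x|) ^ (-(1 + α)) := by ring
      _ ≤ _ := by
        have : 0 ≤ C * (1/2) ^ (-(1 + α)) := by positivity
        gcongr; linarith
  · have hx' := not_le.1 hx
    have h3 := h x ((le_max_left X 1).trans hx'.le)
    calc |ell p α x| ≤ C * |x| ^ (-1 - α) := h3
      _ ≤ C * (1/2 * (1 + |x|)) ^ (-(1 + α)) := by
          rw [show -1 - α = -(1 + α) by ring]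
          apply mul_le_mul_of_nonneg_left _ hC
          exact Real.rpow_le_rpow_of_nonpos (by positivity) (by linarith) (by linarith)
      _ = C * (1/2) ^ (-(1 + α)) * (1 + |x|) ^ (-(1 + α)) := by
          rw [Real.mul_rpow (by norm_num) hpos.le]; ring
      _ ≤ _ := by
        have : 0 ≤ B * (1 + Y) ^ (1 + α) := by positivity
        gcongr; linarith

lemma shift_rpow {b : ℝ} (hb : 0 ≤ b) (x c : ℝ) :
    (1 + |x + c|) ^ (-b) ≤ (1 + |c|) ^ b * (1 + |x|) ^ (-b) := by
  have h1 : 1 + |x| ≤ (1 + |x + c|) * (1 + |c|) := by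
    have : |x| ≤ |x + c| + |c| := by
      have := abs_sub (x + c) c; simpa using this
    nlinarith [abs_nonneg (x + c), abs_nonneg c]
  have p1 : 0 < 1 + |x| := by positivity
  have p2 : 0 < 1 + |x + c| := by positivity
  have p3 : 0 < 1 + |c| := by positivity
  rw [Real.rpow_neg p2.le, Real.rpow_neg p1.le, ← div_eq_mul_inv, inv_eq_one_div,
    div_le_div_iff₀ (by positivity) (by positivity), one_mul, mul_comm, ← Real.mul_rpow p2.le p3.le]
  exact Real.rpow_le_rpow p1.le h1 hb

lemma ell_integrable {α : ℝ} (h1 : 1 < α) (h2 : α < 2) {p : ℕ} (hp : 2 ≤ p) :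
    Integrable (ell p α) := by
  obtain ⟨C, hC, h⟩ := ell_bound h1 h2 hp
  have hi : Integrable (fun x : ℝ => (1 + ‖x‖) ^ (-(1 + α))) :=
    integrable_one_add_norm (by simp; linarith)
  refine Integrable.mono' (hi.const_mul C) (ell_cont h2 hp).aestronglyMeasurable
    (Eventually.of_forall fun x => ?_)
  exact h x

lemma TT_bound {α : ℝ} (h1 : 1 < α) (h2 : α < 2) {p : ℕ} (hp : 2 ≤ p) :
    ∃ C : ℝ, 0 ≤ C ∧ ∀ x, |TT p α x| ≤ C * (1 + |x|) ^ (-(1 + α)) := by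
  obtain ⟨C, hC, h⟩ := ell_bound h1 h2 hp
  refine ⟨|1 / (2 * Real.cos (Real.pi * α / 2))| *
    (C * (1 + |((p:ℝ) + 1) / 2|) ^ (1 + α) + C * (1 + |((p:ℝ) + 1) / 2|) ^ (1 + α)), by positivity,
    fun x => ?_⟩
  rw [TT, abs_mul, mul_assoc]
  gcongr
  refine (abs_add_le _ _).trans ?_
  rw [add_mul, mul_assoc]
  have hs := shift_rpow (b := 1 + α) (by linarith) x (((p:ℝ) + 1) / 2)
  have hs' := shift_rpow (b := 1 + α) (by linarith) (-x) (((p:ℝ) + 1) / 2)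
  rw [abs_neg] at hs'
  exact add_le_add ((h _).trans (by gcongr)) ((h _).trans (by gcongr))

lemma TT_cont {α : ℝ} (h2 : α < 2) {p : ℕ} (hp : 2 ≤ p) : Continuous (TT p α) := by
  unfold TT
  have := ell_cont h2 hp
  fun_prop

lemma ell_neg {α : ℝ} (h2 : α < 2) {p : ℕ} (hp : 2 ≤ p) {x : ℝ} (hx : x < 0) : ell p α x = 0 := by
  have hp' : (2:ℝ) ≤ p := by exact_mod_cast hp
  rw [ell, Finset.sum_eq_zero, mul_zero]
  intro j _
  have : (0:ℝ) ≤ j := Nat.cast_nonneg j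
  rw [pw, max_eq_right (by linarith), Real.zero_rpow (by linarith), mul_zero]

lemma ell_lim {α : ℝ} (h1 : 1 < α) (h2 : α < 2) {p : ℕ} (hp : 2 ≤ p) (ω : ℝ) :
    Tendsto (fun ε : ℝ => ((ε:ℂ) + Complex.I * ω) ^ (-((p + 1 - α : ℝ) : ℂ)) *
      (1 - Complex.exp (-((ε:ℂ) + Complex.I * ω))) ^ (p + 1)) (𝓝[>] 0)
      (𝓝 (∫ x : ℝ, ((ell p α x : ℝ) : ℂ) * Complex.exp (-(Complex.I * ω * x)))) := by
  have key : Tendsto (fun ε : ℝ => ∫ x : ℝ, ((ell p α x : ℝ) : ℂ) *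
      Complex.exp (-(((ε:ℂ) + Complex.I * ω) * x))) (𝓝[>] 0)
      (𝓝 (∫ x : ℝ, ((ell p α x : ℝ) : ℂ) * Complex.exp (-(Complex.I * ω * x)))) := by
    apply tendsto_integral_filter_of_dominated_convergence (fun x => |ell p α x|)
    · refine Eventually.of_forall fun ε => Continuous.aestronglyMeasurable ?_
      have := ell_cont h2 hp
      fun_prop
    · filter_upwards [self_mem_nhdsWithin] with ε hε
      have hε : 0 < ε := hε
      refine Eventually.of_forall fun x => ?_
      rcases lt_or_ge x 0 with hx | hx
      · simp [ell_neg h2 hp hx]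
      · rw [norm_mul, Complex.norm_real, Complex.norm_exp]
        have : (-(((ε:ℂ) + Complex.I * ω) * x)).re = -(ε * x) := by simp
        rw [this, Real.norm_eq_abs]
        have : Real.exp (-(ε * x)) ≤ 1 := Real.exp_le_one_iff.2 (by nlinarith)
        nlinarith [abs_nonneg (ell p α x)]
    · exact (ell_integrable h1 h2 hp).abs
    · refine Eventually.of_forall fun x => ?_
      have hc : Continuous (fun ε : ℝ => ((ell p α x : ℝ) : ℂ) *
          Complex.exp (-(((ε:ℂ) + Complex.I * ω) * x))) := by fun_prop
      have := (hc.tendsto 0).mono_left (nhdsWithin_le_nhds (s := Set.Ioi 0))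
      simpa using this
  refine key.congr' ?_
  filter_upwards [self_mem_nhdsWithin] with ε hε
  exact ell_lap h2 hp (by simpa using hε)

/-- half of the transform -/
lemma ell_fourier {α : ℝ} (h1 : 1 < α) (h2 : α < 2) {p : ℕ} (hp : 2 ≤ p) (ω : ℝ) :
    ∫ x : ℝ, ((ell p α (x + (p + 1) / 2) : ℝ) : ℂ) * Complex.exp (-(Complex.I * ω * x))
      = (Complex.I * ω) ^ (α:ℂ) * ((sincf (ω / 2) : ℝ) : ℂ) ^ (p + 1) := by
  have e1 : ∀ x : ℝ, ((ell p α (x + (p + 1) / 2) : ℝ) : ℂ) * Complex.exp (-(Complex.I * ω * x))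
      = Complex.exp (Complex.I * ω / 2) ^ (p + 1) *
        (fun x : ℝ => ((ell p α x : ℝ) : ℂ) * Complex.exp (-(Complex.I * ω * x))) (x + (p + 1) / 2) := by
    intro x
    simp only
    rw [← Complex.exp_nat_mul, mul_left_comm, ← Complex.exp_add]
    congr 2; push_cast; ring
  simp_rw [e1]
  rw [integral_const_mul, integral_add_right_eq_self
    (fun x : ℝ => ((ell p α x : ℝ) : ℂ) * Complex.exp (-(Complex.I * ω * x))) (((p:ℝ) + 1) / 2)]
  have hl := ell_lim h1 h2 hp ω
  by_cases hω : ω = 0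
  · have hz : Tendsto (fun ε : ℝ => ((ε:ℂ) + Complex.I * ω) ^ (-((p + 1 - α : ℝ) : ℂ)) *
      (1 - Complex.exp (-((ε:ℂ) + Complex.I * ω))) ^ (p + 1)) (𝓝[>] 0) (𝓝 0) := by
      subst hω
      rw [tendsto_zero_iff_norm_tendsto_zero]
      have hb : Tendsto (fun ε : ℝ => ε ^ α) (𝓝[>] 0) (𝓝 0) := by
        have hc : Continuous (fun ε : ℝ => ε ^ α) := Real.continuous_rpow_const (by linarith)
        have := (hc.tendsto 0).mono_left (nhdsWithin_le_nhds (s := Set.Ioi 0))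
        rwa [Real.zero_rpow (by linarith)] at this
      refine squeeze_zero' (Eventually.of_forall fun _ => norm_nonneg _) ?_ hb
      filter_upwards [self_mem_nhdsWithin] with ε hε
      have hε : 0 < ε := hε
      have n1 : ((ε:ℂ) + Complex.I * (0:ℝ)) = (ε:ℂ) := by simp
      rw [n1, ← Complex.ofReal_neg, ← Complex.ofReal_cpow hε.le, norm_mul, Complex.norm_real,
        Real.norm_of_nonneg (by positivity), norm_pow]
      have n2 : ‖1 - Complex.exp (-(ε:ℂ))‖ ≤ ε := by
        have : 1 - Complex.exp (-(ε:ℂ)) = ((1 - Real.exp (-ε) : ℝ) : ℂ) := by push_cast; rfl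
        rw [this, Complex.norm_real, Real.norm_of_nonneg]
        · have := Real.add_one_le_exp (-ε); linarith
        · have := Real.exp_le_one_iff.2 (show -ε ≤ 0 by linarith); linarith
      calc ε ^ (-((p:ℝ) + 1 - α)) * ‖1 - Complex.exp (-(ε:ℂ))‖ ^ (p + 1)
          ≤ ε ^ (-((p:ℝ) + 1 - α)) * ε ^ (p + 1) := by gcongr
        _ = ε ^ α := by
          rw [← Real.rpow_natCast, ← Real.rpow_add hε]; congr 1; push_cast; ring
    rw [tendsto_nhds_unique hl hz, hω]
    simp [Complex.zero_cpow (show (α:ℂ) ≠ 0 by exact_mod_cast (by linarith : α ≠ 0))]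
  · have hne : Complex.I * (ω:ℂ) ≠ 0 := mul_ne_zero Complex.I_ne_zero (by exact_mod_cast hω)
    have hz : Tendsto (fun ε : ℝ => ((ε:ℂ) + Complex.I * ω) ^ (-((p + 1 - α : ℝ) : ℂ)) *
      (1 - Complex.exp (-((ε:ℂ) + Complex.I * ω))) ^ (p + 1)) (𝓝[>] 0)
      (𝓝 ((Complex.I * ω) ^ (-((p + 1 - α : ℝ) : ℂ)) * (1 - Complex.exp (-(Complex.I * ω))) ^ (p + 1))) := by
      have hc : ContinuousAt (fun ε : ℝ => ((ε:ℂ) + Complex.I * ω) ^ (-((p + 1 - α : ℝ) : ℂ)) *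
        (1 - Complex.exp (-((ε:ℂ) + Complex.I * ω))) ^ (p + 1)) 0 := by
        apply ContinuousAt.mul
        · apply ContinuousAt.cpow _ continuousAt_const
          · rw [Complex.mem_slitPlane_iff]; right; simpa using hω
          · fun_prop
        · fun_prop
      have := hc.tendsto.mono_left (nhdsWithin_le_nhds (s := Set.Ioi 0))
      simpa using this
    rw [tendsto_nhds_unique hl hz]
    have hsin : Complex.exp (Complex.I * ω / 2) * (1 - Complex.exp (-(Complex.I * ω)))
        = (Complex.I * ω) * ((sincf (ω / 2) : ℝ) : ℂ) := by
      have hω2 : ω / 2 ≠ 0 := by simpa using hω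
      have hωc : (ω:ℂ) ≠ 0 := by exact_mod_cast hω
      rw [sincf, if_neg hω2, mul_sub, mul_one, ← Complex.exp_add]
      push_cast
      rw [Complex.sin]
      have i1 : Complex.I * ω / 2 + -(Complex.I * ω) = -(ω / 2 : ℂ) * Complex.I := by ring
      have i2 : Complex.I * ω / 2 = (ω / 2 : ℂ) * Complex.I := by ring
      rw [i1, i2]
      generalize Complex.exp (-(↑ω / 2) * Complex.I) = A
      generalize Complex.exp (↑ω / 2 * Complex.I) = B
      field_simp
      linear_combination (B - A) * Complex.I_sq
    rw [mul_left_comm, ← mul_pow, hsin, mul_pow, ← mul_assoc]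
    congr 1
    rw [← Complex.cpow_natCast, ← Complex.cpow_add _ _ hne]
    congr 1; push_cast; ring

lemma cpow_sum (α ω : ℝ) (h1 : 1 < α) :
    (Complex.I * ω) ^ (α:ℂ) + (Complex.I * ((-ω : ℝ):ℂ)) ^ (α:ℂ)
      = ((|ω| ^ α * (2 * Real.cos (Real.pi * α / 2)) : ℝ) : ℂ) := by
  have base : ∀ ω : ℝ, 0 ≤ ω → (Complex.I * ω) ^ (α:ℂ) + (Complex.I * ((-ω : ℝ):ℂ)) ^ (α:ℂ)
      = ((ω ^ α * (2 * Real.cos (Real.pi * α / 2)) : ℝ) : ℂ) := by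
    intro ω hω
    have e1 : (Complex.I * ω) = ((ω:ℝ):ℂ) * Complex.I := by ring
    have e2 : (Complex.I * ((-ω : ℝ):ℂ)) = ((ω:ℝ):ℂ) * (-Complex.I) := by push_cast; ring
    have m : ∀ u : ℂ, u ≠ 0 → (((ω:ℝ):ℂ) * u) ^ (α:ℂ) = (ω:ℂ) ^ (α:ℂ) * u ^ (α:ℂ) := by
      intro u hu
      rcases hω.lt_or_eq with h | h
      · rw [Complex.cpow_def_of_ne_zero (mul_ne_zero (by exact_mod_cast h.ne') hu),
          Complex.cpow_def_of_ne_zero (by exact_mod_cast h.ne'), Complex.cpow_def_of_ne_zero hu,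
          Complex.log_ofReal_mul h hu, ← Complex.exp_add, Complex.ofReal_log h.le]
        congr 1; ring
      · rw [← h]
        simp [Complex.zero_cpow (show (α:ℂ) ≠ 0 by exact_mod_cast (by linarith : α ≠ 0))]
    rw [e1, e2, m _ Complex.I_ne_zero, m _ (neg_ne_zero.2 Complex.I_ne_zero), ← Complex.ofReal_cpow hω,
      ← mul_add, Complex.ofReal_mul]
    congr 1
    rw [Complex.cpow_def_of_ne_zero Complex.I_ne_zero,
      Complex.cpow_def_of_ne_zero (neg_ne_zero.2 Complex.I_ne_zero), Complex.log_I, Complex.log_neg_I]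
    push_cast
    rw [Complex.cos]
    field_simp
  rcases le_total 0 ω with h | h
  · rw [abs_of_nonneg h]; exact base ω h
  · rw [abs_of_nonpos h, ← base (-ω) (by linarith), neg_neg, add_comm]

lemma cos_ne {α : ℝ} (h1 : 1 < α) (h2 : α < 2) : Real.cos (Real.pi * α / 2) ≠ 0 := by
  have hpi := Real.pi_pos
  apply (Real.cos_neg_of_pi_div_two_lt_of_lt _ _).ne
  · nlinarith
  · nlinarith

lemma sincf_neg (x : ℝ) : sincf (-x) = sincf x := by
  unfold sincf
  by_cases h : x = 0 <;> simp [h]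

lemma TT_fourier {α : ℝ} (h1 : 1 < α) (h2 : α < 2) {p : ℕ} (hp : 2 ≤ p) (ω : ℝ) :
    ∫ x : ℝ, ((TT p α x : ℝ) : ℂ) * Complex.exp (-(Complex.I * ω * x))
      = ((|ω| ^ α * sincf (ω / 2) ^ (p + 1) : ℝ) : ℂ) := by
  have hint : ∀ ω : ℝ, Integrable (fun x : ℝ => ((ell p α (x + (p + 1) / 2) : ℝ) : ℂ) * Complex.exp (-(Complex.I * ω * x))) := by
    intro ω
    have h := ((ell_integrable h1 h2 hp).comp_add_right (((p:ℝ) + 1) / 2)).norm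
    refine Integrable.mono' h ?_ (Eventually.of_forall fun x => ?_)
    · apply Continuous.aestronglyMeasurable
      have := ell_cont h2 hp
      fun_prop
    · rw [norm_mul, Complex.norm_real, Complex.norm_exp]
      simp
  set f1 : ℝ → ℝ → ℂ := fun ω x => ((ell p α (x + (p + 1) / 2) : ℝ) : ℂ) * Complex.exp (-(Complex.I * ω * x)) with hf1
  have e : ∀ x : ℝ, ((TT p α x : ℝ) : ℂ) * Complex.exp (-(Complex.I * ω * x))
      = ((1 / (2 * Real.cos (Real.pi * α / 2)) : ℝ) : ℂ) * (f1 ω x + f1 (-ω) (-x)) := by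
    intro x
    simp only [hf1]
    rw [show (-(Complex.I * ((-ω : ℝ):ℂ) * ((-x : ℝ):ℂ))) = -(Complex.I * ω * x) by push_cast; ring, TT]
    push_cast; ring
  simp_rw [e]
  rw [integral_const_mul, integral_add (hint ω) (hint (-ω)).comp_neg, integral_neg_eq_self (f1 (-ω)),
    ell_fourier h1 h2 hp, ell_fourier h1 h2 hp, neg_div, sincf_neg, ← add_mul, cpow_sum α ω h1,
    ← Complex.ofReal_pow, ← Complex.ofReal_mul, ← Complex.ofReal_mul]
  congr 1
  have := cos_ne h1 h2
  field_simp

lemma summable_w {b : ℝ} (hb : 1 < b) : Summable (fun m : ℤ => (1 + |(m:ℝ)|) ^ (-b)) := by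
  have h := (Real.summable_abs_int_rpow hb).add (hasSum_ite_eq (0:ℤ) (1:ℝ)).summable
  refine Summable.of_nonneg_of_le (fun m => by positivity) (fun m => ?_) h
  by_cases hm : m = 0
  · subst hm; simp [Real.zero_rpow (show -b ≠ 0 by linarith)]
  · have : (0:ℝ) < |(m:ℝ)| := by positivity
    simp only [hm, if_false, add_zero]
    exact Real.rpow_le_rpow_of_nonpos this (by linarith) (by linarith)

lemma symb_bound {α : ℝ} (h1 : 1 < α) (h2 : α < 2) {p : ℕ} (hp : 2 ≤ p) (y : ℝ) :
    |(|2 * y| ^ α * sincf y ^ (p + 1))| ≤ 2 ^ ((p:ℝ) + 1) * (1 + |y|) ^ (-((p:ℝ) + 1 - α)) := by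
  have hp' : (2:ℝ) ≤ p := by exact_mod_cast hp
  have hpos : 0 < 1 + |y| := by positivity
  rw [abs_mul, abs_of_nonneg (by positivity : (0:ℝ) ≤ |2 * y| ^ α), abs_pow, abs_mul, abs_two,
    Real.mul_rpow (by norm_num) (abs_nonneg y)]
  have split : (2:ℝ) ^ ((p:ℝ) + 1) = 2 ^ α * (1/2) ^ (-((p:ℝ) + 1 - α)) := by
    rw [one_div, Real.inv_rpow (by norm_num), ← Real.rpow_neg (by norm_num), ← Real.rpow_add (by norm_num)]
    congr 1; ring
  rw [split, mul_assoc, mul_assoc, ← Real.mul_rpow (by norm_num) hpos.le]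
  gcongr
  rcases le_or_gt |y| 1 with h | h
  · have s1 : |sincf y| ≤ 1 := by
      unfold sincf
      split_ifs with h0
      · simp
      · rw [abs_div, div_le_one (abs_pos.2 h0)]; exact Real.abs_sin_le_abs
    have a1 : |y| ^ α * |sincf y| ^ (p + 1) ≤ 1 * 1 :=
      mul_le_mul (Real.rpow_le_one (abs_nonneg y) h (by linarith)) (pow_le_one₀ (abs_nonneg _) s1)
        (by positivity) zero_le_one
    have a2 : 1 ≤ (1 / 2 * (1 + |y|)) ^ (-((p:ℝ) + 1 - α)) :=
      Real.one_le_rpow_of_pos_of_le_one_of_nonpos (by positivity) (by linarith) (by linarith)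
    linarith
  · have y0 : 0 < |y| := by linarith
    have s1 : |sincf y| ≤ |y|⁻¹ := by
      unfold sincf
      rw [if_neg (abs_pos.1 y0), abs_div, div_eq_mul_inv]
      have := Real.abs_sin_le_one y
      have : 0 ≤ |y|⁻¹ := by positivity
      nlinarith
    calc |y| ^ α * |sincf y| ^ (p + 1) ≤ |y| ^ α * (|y|⁻¹) ^ (p + 1) := by gcongr
      _ = |y| ^ (-((p:ℝ) + 1 - α)) := by
        rw [inv_pow, ← Real.rpow_natCast, ← Real.rpow_neg y0.le, ← Real.rpow_add y0]
        congr 1; push_cast; ring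
      _ ≤ _ := Real.rpow_le_rpow_of_nonpos (by positivity) (by linarith) (by linarith)

lemma symb_summable {α : ℝ} (h1 : 1 < α) (h2 : α < 2) {p : ℕ} (hp : 2 ≤ p) (θ : ℝ) :
    Summable (fun l : ℤ => |θ + 2 * (l : ℝ) * Real.pi| ^ α * sincf (θ / 2 + (l : ℝ) * Real.pi) ^ (p + 1)) := by
  have hp' : (2:ℝ) ≤ p := by exact_mod_cast hp
  have hb : 1 < (p:ℝ) + 1 - α := by linarith
  refine Summable.of_norm_bounded (g := fun l : ℤ => (2 ^ ((p:ℝ) + 1) * (1 + |-(θ / 2)|) ^ ((p:ℝ) + 1 - α)) *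
    (1 + |(l:ℝ)|) ^ (-((p:ℝ) + 1 - α))) ((summable_w hb).mul_left _) (fun l => ?_)
  have h := symb_bound h1 h2 hp (θ / 2 + (l : ℝ) * Real.pi)
  rw [show 2 * (θ / 2 + (l : ℝ) * Real.pi) = θ + 2 * (l : ℝ) * Real.pi by ring] at h
  rw [Real.norm_eq_abs]
  refine h.trans ?_
  rw [mul_assoc]
  gcongr
  have h3 := shift_rpow (b := (p:ℝ) + 1 - α) (by linarith) (l * Real.pi) (θ / 2)
  rw [abs_neg, add_comm (θ / 2)]
  refine h3.trans ?_
  gcongr ?_ * ?_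
  apply Real.rpow_le_rpow_of_nonpos (by positivity) _ (by linarith)
  rw [abs_mul, abs_of_pos Real.pi_pos]
  have := Real.pi_gt_three
  nlinarith [abs_nonneg (l:ℝ)]

open scoped FourierTransform in
lemma symb_poisson {α : ℝ} (h1 : 1 < α) (h2 : α < 2) {p : ℕ} (hp : 2 ≤ p) (θ : ℝ) :
    ((fSymbol p α θ : ℝ) : ℂ) = ∑' m : ℤ, (tco p α m : ℂ) * Complex.exp (Complex.I * m * θ) := by
  set f : ℝ → ℂ := fun x => ((TT p α x : ℝ) : ℂ) * Complex.exp (-(Complex.I * θ * x)) with hf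
  have hc : Continuous f := by
    have := TT_cont h2 hp
    rw [hf]; fun_prop
  have hF : ∀ n : ℤ, 𝓕 f n
      = ((|θ + 2 * (n : ℝ) * Real.pi| ^ α * sincf (θ / 2 + (n : ℝ) * Real.pi) ^ (p + 1) : ℝ) : ℂ) := by
    intro n
    rw [Real.fourier_real_eq_integral_exp_smul]
    have h := TT_fourier h1 h2 hp (θ + 2 * (n : ℝ) * Real.pi)
    rw [show (θ + 2 * (n : ℝ) * Real.pi) / 2 = θ / 2 + (n : ℝ) * Real.pi by ring] at h
    rw [← h]
    congr 1; ext x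
    simp only [hf, smul_eq_mul]
    rw [mul_left_comm, ← Complex.exp_add]
    congr 2; push_cast; ring
  have hO : f =O[cocompact ℝ] fun x : ℝ => |x| ^ (-(1 + α)) := by
    obtain ⟨C, hC, h⟩ := TT_bound h1 h2 hp
    refine Asymptotics.IsBigO.of_bound C ?_
    have := (tendsto_norm_cocompact_atTop (E := ℝ)).eventually_ge_atTop 1
    filter_upwards [this] with x hx
    rw [Real.norm_eq_abs] at hx
    have n1 : ‖f x‖ = |TT p α x| := by
      rw [hf]; simp only [norm_mul, Complex.norm_real, Complex.norm_exp]; simp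
    rw [n1, Real.norm_of_nonneg (by positivity)]
    refine (h x).trans (mul_le_mul_of_nonneg_left ?_ hC)
    exact Real.rpow_le_rpow_of_nonpos (by linarith) (by linarith) (by linarith)
  have hS : Summable (fun n : ℤ => 𝓕 f n) := by
    simp_rw [hF]
    exact_mod_cast Complex.hasSum_ofReal.2 (symb_summable h1 h2 hp θ).hasSum |>.summable
  have P := Real.tsum_eq_tsum_fourier_of_rpow_decay_of_summable hc (by linarith : 1 < 1 + α) hO hS 0
  have Z : ∀ n : ℤ, fourier n ((0:ℝ) : UnitAddCircle) = (1:ℂ) := by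
    intro n
    simp
  simp_rw [Z, mul_one, hF, zero_add] at P
  rw [fSymbol, Complex.ofReal_tsum, ← P, ← (Equiv.neg ℤ).tsum_eq]
  apply tsum_congr
  intro m
  simp only [hf, Equiv.neg_apply]
  rw [tco_eq h1 h2 hp, Int.cast_neg, TT_even]
  congr 2; push_cast; ring

end FourierPart

theorem symbdata {α : ℝ} (h1 : 1 < α) (h2 : α < 2) {p : ℕ} (hp : 2 ≤ p) (C : ℝ) (hC0 : 0 ≤ C)
    (hC : ∀ a b a' b', a ≤ p + 1 → b ≤ p + 1 → a' ≤ p + 1 → b' ≤ p + 1 → ∀ m : ℤ,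
      |Lam p α a b a' b' m| ≤ C * (1 + |(m:ℝ)|) ^ (-1 - α)) :
    SymbolData (fun m : ℤ => C * (1 + |(m:ℝ)|) ^ (-1 - α)) (tco p α) (fSymbol p α) where
  w0 m := by positivity
  hw := by
    have := (summable_w (b := 1 + α) (by linarith)).mul_left C
    rw [show -(1 + α) = -1 - α by ring] at this
    exact this
  tw m := hC _ _ _ _ (by omega) le_rfl (by omega) le_rfl m
  teven m := by
    rw [tco_eq h1 h2 hp, tco_eq h1 h2 hp, Int.cast_neg, TT_even]
  hf θ := symb_poisson h1 h2 hp θ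

theorem stmt19 (p : ℕ) (hp : 2 ≤ p) (α : ℝ) (h1 : 1 < α) (h2 : α < 2) :
    ∀ F : ℂ → ℂ, Continuous F → HasCompactSupport F →
      Filter.Tendsto
        (fun n : ℕ =>
          (1 / ((n + p - 2 : ℕ) : ℂ)) *
            ((((((n : ℝ) ^ (-α)) • Amat p n α).map (fun x => (x : ℂ))).charpoly.roots.map F).sum))
        Filter.atTop
        (nhds (((1 / (2 * Real.pi) : ℝ) : ℂ) *
          ∫ θ in (-Real.pi)..Real.pi, F ((fSymbol p α θ : ℝ) : ℂ))) := by
  intro F hF hc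
  obtain ⟨C, hC0, hC⟩ := Lam_bound (p := p) h1
  refine abstract_main (symbdata h1 h2 hp C hC0 hC) (p + 1) (fun n => n + p - 2) ?_
    (fun n => ((n : ℝ) ^ (-α)) • Amat p n α) ?_ F hF hc
  · refine Filter.tendsto_atTop_mono (fun n => ?_) Filter.tendsto_id
    simp only [id]; omega
  · filter_upwards [Filter.eventually_ge_atTop 1] with n hn
    exact matdata hp h1 hn C hC
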